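/- arXiv:1507.06329 — 3 statements merged into one kernel-verified Lean document; each statement's English description precedes it below -/
import Mathlib

section
/- Let 𝔽_q be a finite field of characteristic p, and let f(x) ∈ 𝔽_q[x] be a polynomial of degree d with p ∤ d. Let D ⊆ 𝔽_q with |D| = q - c, and assume q - c ≥ (d-1)√q + c. Then for every b ∈ 𝔽_q and every 0 ≤ k ≤ |D|, |N_f(D,k,b) - (1/q)·C(q-c, k)| ≤ C((q-c)/p + ((p-1)/p)·((d-1)·q^{1/2} + c) + k - 1, k). -/
open Finset

/-- `N_f(D, k, b)`: the number of `k`-element subsets `S ⊆ D` with `∑_{x ∈ S} f(x) = b`. -/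
def polySubsetSumCount {R : Type*} [CommRing R] [DecidableEq R]
    (D : Finset R) (f : Polynomial R) (k : ℕ) (b : R) : ℕ :=
  ((D.powersetCard k).filter (fun S => ∑ x ∈ S, f.eval x = b)).card

/-- The real "binomial coefficient" `C(x, k) = x(x-1)⋯(x-k+1)/k!`. -/
noncomputable def realChoose (x : ℝ) (k : ℕ) : ℝ :=
  (∏ j ∈ Finset.range k, (x - j)) / (Nat.factorial k)

theorem mul_esymm_eq_sum_range {R : Type*} [CommRing R] (s : Multiset R) (k : ℕ) :
    (k : R) * s.esymm k =
      ∑ i ∈ range k, (-1) ^ (k + i + 1) * s.esymm i * (s.map (fun x => x ^ (k - i))).sum := by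
  classical
  have h := congrArg (MvPolynomial.aeval (R := R) (fun x : s.ToType => (x : R)))
    (MvPolynomial.mul_esymm_eq_sum s.ToType R k)
  have hs : (univ : Finset s.ToType).val.map (fun x : s.ToType => (x : R)) = s :=
    Multiset.map_univ_coe s
  have hp : ∀ j : ℕ, ∑ x : s.ToType, (x : R) ^ j = (s.map (fun x => x ^ j)).sum := by
    intro j
    conv_rhs => rw [← hs]
    rw [Multiset.map_map]
    rfl
  simp only [map_mul, map_natCast, map_sum, map_pow, map_neg, map_one,
    MvPolynomial.aeval_esymm_eq_multiset_esymm, hs, MvPolynomial.psum, MvPolynomial.aeval_X, hp] at h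
  rw [h, Finset.sum_filter, Finset.Nat.sum_antidiagonal_eq_sum_range_succ_mk, sum_range_succ]
  simp only [lt_irrefl, if_false, add_zero, mul_sum]
  refine sum_congr rfl fun i hi => ?_
  rw [if_pos (mem_range.1 hi)]
  ring

theorem mul_sum_powersetCard_prod {ι R : Type*} [CommRing R] (D : Finset ι) (v : ι → R)
    (k : ℕ) :
    (k : R) * ∑ S ∈ D.powersetCard k, ∏ x ∈ S, v x =
      ∑ i ∈ range k, (-1) ^ (k + i + 1) * (∑ S ∈ D.powersetCard i, ∏ x ∈ S, v x) *
        ∑ x ∈ D, v x ^ (k - i) := by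
  have h := mul_esymm_eq_sum_range (D.val.map v) k
  simpa only [Finset.esymm_map_val, Multiset.map_map, Function.comp_def, Finset.sum] using h

theorem sum_dvd_sub_le_sum_range {u : ℕ → ℝ} (hu : Monotone u) (hu0 : ∀ n, 0 ≤ u n) {p : ℕ}
    (hp : 0 < p) (n : ℕ) :
    p * ∑ i ∈ range n, (if p ∣ n - i then u i else 0) ≤ ∑ i ∈ range n, u i := by
  induction n using Nat.strong_induction_on with
  | _ n ih =>
    rcases lt_or_ge n p with hn | hn
    · have h0 : ∑ i ∈ range n, (if p ∣ n - i then u i else 0) = 0 := by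
        refine sum_eq_zero fun i hi => if_neg fun hdvd => ?_
        have := mem_range.1 hi
        have := Nat.le_of_dvd (by omega) hdvd
        omega
      rw [h0, mul_zero]
      exact sum_nonneg fun i _ => hu0 i
    · obtain ⟨m, rfl⟩ := Nat.exists_eq_add_of_le' hn
      rw [sum_range_add, sum_range_add, mul_add]
      refine add_le_add ?_ ?_
      · refine le_trans (le_of_eq ?_) (ih m (by omega))
        congr 1
        refine sum_congr rfl fun i hi => ?_
        have hi := mem_range.1 hi
        rw [show m + p - i = (m - i) + p by omega]
        simp
      · have h1 : ∑ t ∈ range p, (if p ∣ m + p - (m + t) then u (m + t) else 0) = u m := by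
          rw [sum_eq_single_of_mem 0 (mem_range.2 hp)]
          · simp
          · intro t ht ht0
            refine if_neg fun hdvd => ?_
            have := mem_range.1 ht
            have := Nat.le_of_dvd (by omega) hdvd
            omega
        rw [h1]
        calc (p : ℝ) * u m = ∑ t ∈ range p, u m := by simp
          _ ≤ _ := sum_le_sum fun t _ => hu (by omega)

theorem realChoose_add_sub_one (X : ℝ) (n : ℕ) :
    realChoose (X + n - 1) n = (∏ j ∈ range n, (X + j)) / n.factorial := by
  rw [realChoose, ← prod_range_reflect]
  congr 1
  refine prod_congr rfl fun j hj => ?_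
  have := mem_range.1 hj
  rw [Nat.sub_sub, Nat.cast_sub (by omega)]
  push_cast
  ring

theorem succ_mul_realChoose (X : ℝ) (n : ℕ) :
    ((n + 1 : ℕ) : ℝ) * realChoose (X + (n + 1 : ℕ) - 1) (n + 1) =
      (X + n) * realChoose (X + n - 1) n := by
  rw [realChoose_add_sub_one, realChoose_add_sub_one, prod_range_succ, Nat.factorial_succ]
  have := Nat.factorial_ne_zero n
  push_cast
  field_simp

theorem mul_realChoose_eq_sum (X : ℝ) (n : ℕ) :
    (n : ℝ) * realChoose (X + n - 1) n = X * ∑ i ∈ range n, realChoose (X + i - 1) i := by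
  induction n with
  | zero => simp
  | succ n ih => rw [succ_mul_realChoose, sum_range_succ, mul_add, ← ih]; ring

theorem realChoose_nonneg {X : ℝ} (hX : 0 ≤ X) (n : ℕ) : 0 ≤ realChoose (X + n - 1) n := by
  rw [realChoose_add_sub_one]
  positivity

theorem monotone_realChoose {X : ℝ} (hX : 1 ≤ X) :
    Monotone fun n : ℕ => realChoose (X + n - 1) n := by
  refine monotone_nat_of_le_succ fun n => ?_
  have h := succ_mul_realChoose X n
  have h0 := realChoose_nonneg (zero_le_one.trans hX) n
  have hn : (0 : ℝ) < ((n + 1 : ℕ) : ℝ) := by positivity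
  refine le_of_mul_le_mul_left ?_ hn
  rw [h]
  refine mul_le_mul_of_nonneg_right ?_ h0
  push_cast
  linarith

theorem le_realChoose_of_recurrence {A B : ℝ} {p : ℕ} (hp : 0 < p) (hB : 0 ≤ B) (hAB : B ≤ A)
    (hX : 1 ≤ A / p + ((p - 1 : ℝ) / p) * B) {E : ℕ → ℝ} (h0 : E 0 ≤ 1)
    (hE : ∀ n, n * E n ≤ ∑ i ∈ range n, E i * (if p ∣ n - i then A else B)) (n : ℕ) :
    E n ≤ realChoose (A / p + ((p - 1 : ℝ) / p) * B + n - 1) n := by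
  set X := A / p + ((p - 1 : ℝ) / p) * B with hXdef
  have hp' : (0 : ℝ) < p := by exact_mod_cast hp
  induction n using Nat.strong_induction_on with
  | _ n ih =>
    rcases Nat.eq_zero_or_pos n with rfl | hn
    · simpa [realChoose] using h0
    · have hn' : (0 : ℝ) < n := by exact_mod_cast hn
      refine le_of_mul_le_mul_left ?_ hn'
      rw [mul_realChoose_eq_sum]
      refine (hE n).trans ?_
      have hmono := sum_dvd_sub_le_sum_range (monotone_realChoose hX)
        (fun n => realChoose_nonneg (zero_le_one.trans hX) n) hp n
      calc ∑ i ∈ range n, E i * (if p ∣ n - i then A else B)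
          ≤ ∑ i ∈ range n, realChoose (X + i - 1) i * (if p ∣ n - i then A else B) := by
            refine sum_le_sum fun i hi => ?_
            refine mul_le_mul_of_nonneg_right (ih i (mem_range.1 hi)) ?_
            split_ifs <;> linarith
        _ = B * ∑ i ∈ range n, realChoose (X + i - 1) i + (A - B) *
              ∑ i ∈ range n, (if p ∣ n - i then realChoose (X + i - 1) i else 0) := by
            rw [mul_sum, mul_sum, ← sum_add_distrib]
            refine sum_congr rfl fun i _ => ?_
            split_ifs <;> ring
        _ ≤ B * ∑ i ∈ range n, realChoose (X + i - 1) i + (A - B) *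
              ((∑ i ∈ range n, realChoose (X + i - 1) i) / p) := by
            gcongr
            rw [le_div_iff₀ hp', mul_comm]
            exact hmono
        _ = X * ∑ i ∈ range n, realChoose (X + i - 1) i := by
            rw [hXdef]
            field_simp
            ring

open Polynomial in
theorem exists_artinSchreier_reduction {K : Type*} [Field K] {p d : ℕ} (hp : 2 ≤ p) {f : K[X]}
    (hf : f.natDegree = d) (hd : 0 < d) (j i : ℕ) :
    ∃ r : ℕ → K[X], (∀ b < p, ∀ a, p * i + d * j < p * a + d * b → (r b).coeff a = 0) ∧
      (∃ b < p, ∃ a, p * a + d * b = p * i + d * j ∧ (r b).coeff a ≠ 0) ∧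
      ∀ x y : K, y ^ p - y = f.eval x → ∑ b ∈ range p, (r b).eval x * y ^ b = x ^ i * y ^ j := by
  induction j using Nat.strong_induction_on generalizing i with
  | _ j ih =>
    rcases lt_or_ge j p with hj | hj
    · refine ⟨fun b => if b = j then X ^ i else 0, fun b _ a hab => ?_, ⟨j, hj, i, rfl, ?_⟩,
        fun x y _ => ?_⟩
      · dsimp only
        split_ifs with h
        · subst h
          rw [coeff_X_pow, if_neg]
          rintro rfl
          exact lt_irrefl _ hab
        · simp
      · simp
      · rw [sum_eq_single_of_mem j (mem_range.2 hj)]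
        · simp
        · intro b _ hb
          simp [hb]
    · obtain ⟨j', rfl⟩ := Nat.exists_eq_add_of_le' hj
      obtain ⟨r₁, h₁, -, h₁e⟩ := ih (j' + 1) (by omega) i
      choose r₂ h₂ h₂t h₂e using fun k => ih j' (by omega) (i + k)
      have hlt : d * (j' + 1) < d * (j' + p) := Nat.mul_lt_mul_of_pos_left (by omega) hd
      have hw : p * (i + d) + d * j' = p * i + d * (j' + p) := by ring
      refine ⟨fun b => r₁ b + ∑ k ∈ range (d + 1), C (f.coeff k) * r₂ k b, fun b hb a hab => ?_, ?_,
        fun x y hxy => ?_⟩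
      · rw [coeff_add, finsetSum_coeff, h₁ b hb a (by omega), zero_add]
        refine sum_eq_zero fun k hk => ?_
        have hk : k ≤ d := Nat.lt_succ_iff.1 (mem_range.1 hk)
        have : p * (i + k) ≤ p * (i + d) := Nat.mul_le_mul_left _ (by omega)
        rw [coeff_C_mul, h₂ k b hb a (by omega), mul_zero]
      · obtain ⟨b, hb, a, hab, hne⟩ := h₂t d
        refine ⟨b, hb, a, by omega, ?_⟩
        rw [coeff_add, finsetSum_coeff, h₁ b hb a (by omega), zero_add, sum_range_succ,
          sum_eq_zero, zero_add, coeff_C_mul]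
        · refine mul_ne_zero ?_ hne
          rw [← hf, coeff_natDegree, leadingCoeff_ne_zero]
          rintro rfl
          simp at hf
          omega
        · intro k hk
          have : p * (i + k) < p * (i + d) :=
            Nat.mul_lt_mul_of_pos_left (by have := mem_range.1 hk; omega) (by omega)
          rw [coeff_C_mul, h₂ k b hb a (by omega), mul_zero]
      · have hfx : f.eval x = ∑ k ∈ range (d + 1), f.coeff k * x ^ k := by
          rw [← hf, eval_eq_sum_range]
        have hy : x ^ i * y ^ (j' + p) = x ^ i * y ^ (j' + 1) + x ^ i * y ^ j' * f.eval x := by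
          rw [← hxy]
          ring
        rw [hy, hfx, mul_sum, ← h₁e x y hxy]
        simp only [eval_add, add_mul, sum_add_distrib, eval_finsetSum, eval_mul, eval_C, sum_mul]
        congr 1
        rw [sum_comm]
        refine sum_congr rfl fun k _ => ?_
        have := h₂e k x y hxy
        rw [show x ^ i * y ^ j' * (f.coeff k * x ^ k) = f.coeff k * (x ^ (i + k) * y ^ j') by ring,
          ← this, mul_sum]
        exact sum_congr rfl fun b _ => by ring

/-- The exponents `(a, b)` of the monomials `x ^ a * y ^ b` with `b < p` and weight
`p * a + d * b` at most `n`. -/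
def weightedExponents (p d n : ℕ) : Finset (ℕ × ℕ) :=
  (range (n + 1) ×ˢ range p).filter fun t => p * t.1 + d * t.2 ≤ n

theorem mem_weightedExponents {p d n : ℕ} (hp : 0 < p) {t : ℕ × ℕ} :
    t ∈ weightedExponents p d n ↔ t.2 < p ∧ p * t.1 + d * t.2 ≤ n := by
  simp only [weightedExponents, mem_filter, mem_product, mem_range]
  constructor
  · rintro ⟨⟨-, h⟩, h'⟩
    exact ⟨h, h'⟩
  · rintro ⟨h, h'⟩
    have := Nat.le_mul_of_pos_left t.1 hp
    exact ⟨⟨by omega, h⟩, h'⟩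

theorem weight_injective {p d : ℕ} (hcop : p.Coprime d) {a b a' b' : ℕ} (hb : b < p) (hb' : b' < p)
    (h : p * a + d * b = p * a' + d * b') : a = a' ∧ b = b' := by
  have hp : 0 < p := by omega
  have h1 : d * b ≡ d * b' [MOD p] := by
    have h2 : (p * a + d * b) % p = (p * a' + d * b') % p := by rw [h]
    simpa [Nat.ModEq, Nat.mul_add_mod] using h2
  have h3 : b = b' := Nat.ModEq.eq_of_lt_of_lt
    (Nat.ModEq.cancel_left_of_coprime hcop h1) hb hb'
  subst h3
  exact ⟨Nat.eq_of_mul_eq_mul_left hp (by omega), rfl⟩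

theorem card_weightedExponents_le {p d : ℕ} (hp : 0 < p) (hcop : p.Coprime d) (n : ℕ) :
    (weightedExponents p d n).card ≤ n + 1 := by
  rw [← card_range (n + 1)]
  refine card_le_card_of_injOn (fun t => p * t.1 + d * t.2) (fun t ht => ?_)
    (fun t ht t' ht' h => ?_)
  · have := ((mem_weightedExponents hp).1 ht).2
    simp only [coe_range, Set.mem_Iio]
    omega
  · exact Prod.ext_iff.2 (weight_injective hcop ((mem_weightedExponents hp).1 ht).1
      ((mem_weightedExponents hp).1 ht').1 h)

theorem le_card_weightedExponents {p d : ℕ} (hp : 0 < p) (hcop : p.Coprime d) (n : ℕ) :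
    n + 1 ≤ (weightedExponents p d n).card + d * p := by
  have hsub : Icc (d * p) n ⊆ (weightedExponents p d n).image fun t => p * t.1 + d * t.2 := by
    intro w hw
    obtain ⟨hw1, hw2⟩ := mem_Icc.1 hw
    have hinj : Set.InjOn (fun b => d * b % p) (range p) := by
      intro b hb b' hb' h
      exact Nat.ModEq.eq_of_lt_of_lt (Nat.ModEq.cancel_left_of_coprime hcop h)
        (mem_range.1 hb) (mem_range.1 hb')
    have hmaps : Set.MapsTo (fun b => d * b % p) (range p) (range p) := fun b _ => by
      simpa using Nat.mod_lt _ hp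
    obtain ⟨b, hb, hbw⟩ := surjOn_of_injOn_of_card_le _ hmaps hinj le_rfl
      (show w % p ∈ (range p : Set ℕ) by simpa using Nat.mod_lt _ hp)
    have hb := mem_range.1 hb
    have hle : d * b ≤ w := (Nat.mul_le_mul_left d hb.le).trans hw1
    obtain ⟨a, ha⟩ := (Nat.modEq_iff_dvd' hle).1 hbw
    refine mem_image.2 ⟨(a, b), (mem_weightedExponents hp).2 ⟨hb, ?_⟩, ?_⟩ <;>
      dsimp only <;> omega
  have h := (card_le_card hsub).trans card_image_le
  rw [Nat.card_Icc] at h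
  omega

theorem exists_ne_zero_sum_mul_eq_zero {K α β : Type*} [Field K] {A : Finset α} {B : Finset β}
    (hlt : B.card < A.card) (M : α → β → K) :
    ∃ v : α → K, (∃ a ∈ A, v a ≠ 0) ∧ ∀ b ∈ B, ∑ a ∈ A, v a * M a b = 0 := by
  classical
  let Φ : (A → K) →ₗ[K] (B → K) := LinearMap.pi fun b => ∑ a : A, M a b • LinearMap.proj a
  have hker : LinearMap.ker Φ ≠ ⊥ := LinearMap.ker_ne_bot_of_finrank_lt (by simpa using hlt)
  obtain ⟨v, hv, hv0⟩ := (Submodule.ne_bot_iff _).1 hker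
  obtain ⟨a, ha⟩ := Function.ne_iff.1 hv0
  refine ⟨fun a => if h : a ∈ A then v ⟨a, h⟩ else 0, ⟨a, a.2, by simpa using ha⟩, fun b hb => ?_⟩
  have h := congrFun (LinearMap.mem_ker.1 hv) ⟨b, hb⟩
  rw [← sum_coe_sort]
  simpa [Φ, mul_comm] using h

open Polynomial in
theorem exists_artinSchreier_auxiliary {K : Type*} [Field K] [Fintype K] {p : ℕ} [Fact p.Prime]
    [CharP K p] {f : K[X]} {d : ℕ} (hf : f.natDegree = d) (hd : ¬ p ∣ d) {s q : ℕ} (hq : q = p ^ s)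
    (hK : Fintype.card K = q * q) (hlarge : (d * p) ^ 2 + 3 * (d * p) + 1 < q) :
    ∃ r : ℕ → K[X], (∃ b < p, r b ≠ 0) ∧
      (∀ b < p, p * (r b).natDegree ≤ (q - 1) + q * (q + 2 * (d * p))) ∧
      ∀ x y : K, y ^ p - y = f.eval x → ∑ b ∈ range p, (r b).eval x * y ^ b = 0 := by
  classical
  have hprime : p.Prime := Fact.out
  have hp0 := hprime.pos
  have hcop : p.Coprime d := (Nat.Prime.coprime_iff_not_dvd hprime).2 hd
  have hd0 : 0 < d := Nat.pos_of_ne_zero fun h => hd (h ▸ dvd_zero _)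
  obtain ⟨l, rfl⟩ : ∃ l, q = l + 1 := ⟨q - 1, by omega⟩
  set q := l + 1 with hql
  clear_value q
  set G := d * p with hG
  set m := q + 2 * G with hm
  choose ρ hρ hρt hρe using fun i j => exists_artinSchreier_reduction hprime.two_le hf hd0 j i
  let A := weightedExponents p d m ×ˢ weightedExponents p d l
  let B := weightedExponents p d (q * l + m)
  have hmem : ∀ t ∈ A, (t.1.2 < p ∧ p * t.1.1 + d * t.1.2 ≤ m) ∧
      (t.2.2 < p ∧ p * t.2.1 + d * t.2.2 ≤ l) := fun t ht =>
    ⟨(mem_weightedExponents hp0).1 (mem_product.1 ht).1,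
      (mem_weightedExponents hp0).1 (mem_product.1 ht).2⟩
  have hcard : B.card < A.card := by
    have h1 : B.card ≤ q * l + m + 1 := card_weightedExponents_le hp0 hcop _
    have h2 : m + 1 ≤ (weightedExponents p d m).card + G := le_card_weightedExponents hp0 hcop m
    have h3 : l + 1 ≤ (weightedExponents p d l).card + G := le_card_weightedExponents hp0 hcop l
    have h4 : A.card = (weightedExponents p d m).card * (weightedExponents p d l).card :=
      card_product _ _
    have h5 : q + G + 1 ≤ (weightedExponents p d m).card := by omega
    obtain ⟨e, he⟩ := Nat.exists_eq_add_of_le (show G ≤ q by nlinarith)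
    have h6 : e ≤ (weightedExponents p d l).card := by omega
    have h7 := Nat.mul_le_mul h5 h6
    have h8 : l = G + e - 1 := by omega
    have h9 : q * l + q = q * q := by rw [hql]; ring
    rw [h4]
    refine lt_of_le_of_lt h1 (lt_of_lt_of_le ?_ h7)
    have h10 : q * l + m + 1 = q * q + 2 * G + 1 := by omega
    rw [h10, he]
    nlinarith
  obtain ⟨v, ⟨t₀, ht₀, hvt₀⟩, hv⟩ := exists_ne_zero_sum_mul_eq_zero hcard
    fun t u => (ρ (t.2.1 * q + t.1.1) (t.2.2 * q + t.1.2) u.2).coeff u.1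
  have hR : ∀ b < p, ∑ t ∈ A, C (v t) * ρ (t.2.1 * q + t.1.1) (t.2.2 * q + t.1.2) b = 0 := by
    intro b hb
    ext a
    rw [finsetSum_coeff, coeff_zero]
    simp only [coeff_C_mul]
    by_cases hab : (a, b) ∈ B
    · exact hv (a, b) hab
    · refine sum_eq_zero fun t ht => ?_
      obtain ⟨⟨-, h1⟩, -, h2⟩ := hmem t ht
      have h3 : q * l + m < p * a + d * b := by
        by_contra! h
        exact hab ((mem_weightedExponents hp0).2 ⟨hb, h⟩)
      rw [hρ _ _ b hb a, mul_zero]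
      refine lt_of_le_of_lt ?_ h3
      calc _ = q * (p * t.2.1 + d * t.2.2) + (p * t.1.1 + d * t.1.2) := by ring
        _ ≤ _ := by gcongr
  have hpow : ∀ x : K, (x ^ q) ^ q = x := fun x => by rw [← pow_mul, ← hK, FiniteField.pow_card]
  let r : ℕ → K[X] := fun b =>
    ∑ t ∈ A, C (v t ^ q) * ρ (t.2.1 + t.1.1 * q) (t.2.2 + t.1.2 * q) b
  have hw : ∀ t : (ℕ × ℕ) × ℕ × ℕ, p * (t.2.1 + t.1.1 * q) + d * (t.2.2 + t.1.2 * q) =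
      (p * t.2.1 + d * t.2.2) + q * (p * t.1.1 + d * t.1.2) := fun t => by ring
  refine ⟨r, ?_, fun b hb => ?_, fun x y hxy => ?_⟩
  · obtain ⟨t₁, ht₁, hmax⟩ := exists_max_image (A.filter fun t => v t ≠ 0)
      (fun t => (p * t.2.1 + d * t.2.2) + q * (p * t.1.1 + d * t.1.2))
      ⟨t₀, mem_filter.2 ⟨ht₀, hvt₀⟩⟩
    obtain ⟨htA, hvt₁⟩ := mem_filter.1 ht₁
    obtain ⟨b, hb, a, hab, hne⟩ := hρt (t₁.2.1 + t₁.1.1 * q) (t₁.2.2 + t₁.1.2 * q)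
    refine ⟨b, hb, fun h0 => ?_⟩
    have h1 : (r b).coeff a = 0 := by rw [h0, coeff_zero]
    rw [finsetSum_coeff, sum_eq_single_of_mem t₁ htA, coeff_C_mul] at h1
    · exact mul_ne_zero (pow_ne_zero _ hvt₁) hne h1
    · intro t ht hne
      rw [coeff_C_mul]
      by_cases hvt : v t = 0
      · rw [hvt, zero_pow (by omega), zero_mul]
      · rw [hρ _ _ b hb a, mul_zero]
        rw [hab, hw, hw]
        refine lt_of_le_of_ne (hmax t (mem_filter.2 ⟨ht, hvt⟩)) fun h => hne ?_
        obtain ⟨⟨h1, -⟩, h2, h3⟩ := hmem t ht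
        obtain ⟨⟨h4, -⟩, h5, h6⟩ := hmem t₁ htA
        have h7 := congrArg (· % q) h
        have h8 := congrArg (· / q) h
        simp only [Nat.add_mul_mod_self_left] at h7
        rw [Nat.mod_eq_of_lt (by omega), Nat.mod_eq_of_lt (by omega)] at h7
        simp only [Nat.add_mul_div_left _ _ (show 0 < q by omega)] at h8
        rw [Nat.div_eq_of_lt (by omega), Nat.div_eq_of_lt (by omega), zero_add, zero_add] at h8
        obtain ⟨e1, e2⟩ := weight_injective hcop h1 h4 h8
        obtain ⟨e3, e4⟩ := weight_injective hcop h2 h5 h7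
        exact Prod.ext (Prod.ext e1 e2) (Prod.ext e3 e4)
  · by_contra! hlt
    have h0 : r b = 0 := by
      rw [← leadingCoeff_eq_zero, leadingCoeff, finsetSum_coeff]
      refine sum_eq_zero fun t ht => ?_
      obtain ⟨⟨-, h1⟩, -, h2⟩ := hmem t ht
      rw [coeff_C_mul, hρ _ _ b hb _, mul_zero]
      rw [hw]
      refine lt_of_lt_of_le (lt_of_le_of_lt ?_ hlt) (Nat.le_add_right _ _)
      exact Nat.add_le_add (by omega) (Nat.mul_le_mul_left _ h1)
    rw [h0, natDegree_zero, mul_zero] at hlt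
    omega
  · have h1 : ∑ t ∈ A, v t * (x ^ (t.2.1 * q + t.1.1) * y ^ (t.2.2 * q + t.1.2)) = 0 := by
      calc _ = ∑ t ∈ A, ∑ b ∈ range p, v t *
            ((ρ (t.2.1 * q + t.1.1) (t.2.2 * q + t.1.2) b).eval x * y ^ b) :=
          sum_congr rfl fun t _ => by rw [← hρe _ _ x y hxy, mul_sum]
        _ = ∑ b ∈ range p,
            (∑ t ∈ A, C (v t) * ρ (t.2.1 * q + t.1.1) (t.2.2 * q + t.1.2) b).eval x * y ^ b := by
          rw [sum_comm]
          simp only [eval_finsetSum, eval_mul, eval_C, sum_mul, mul_assoc]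
        _ = 0 := sum_eq_zero fun b hb => by rw [hR b (mem_range.1 hb), eval_zero, zero_mul]
    have h2 : ∑ b ∈ range p, (r b).eval x * y ^ b =
        ∑ t ∈ A, v t ^ q * (x ^ (t.2.1 + t.1.1 * q) * y ^ (t.2.2 + t.1.2 * q)) := by
      symm
      calc _ = ∑ t ∈ A, ∑ b ∈ range p, v t ^ q *
            ((ρ (t.2.1 + t.1.1 * q) (t.2.2 + t.1.2 * q) b).eval x * y ^ b) :=
          sum_congr rfl fun t _ => by rw [← hρe _ _ x y hxy, mul_sum]
        _ = _ := by
          rw [sum_comm]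
          simp only [r, eval_finsetSum, eval_mul, eval_C, sum_mul, mul_assoc]
    rw [h2]
    refine pow_eq_zero_iff (n := q) (by omega) |>.1 ?_
    rw [← h1]
    conv_lhs => rw [hq]
    rw [sum_pow_char_pow]
    rw [← hq]
    refine sum_congr rfl fun t _ => ?_
    have h3 : ∀ (z : K) (i a : ℕ), (z ^ (i + a * q)) ^ q = z ^ (i * q + a) := fun z i a => by
      calc _ = z ^ (i * q) * ((z ^ q) ^ q) ^ a := by ring
        _ = _ := by rw [hpow, pow_add]
    rw [mul_pow, mul_pow, hpow, h3, h3]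

open Polynomial in
/-- Stepanov's method for the curve `y ^ p - y = f x`. -/
theorem mul_card_filter_exists_pow_sub_self_eq_le {K : Type*} [Field K] [Fintype K] [DecidableEq K]
    {p : ℕ} [Fact p.Prime] [CharP K p] {f : K[X]} {d : ℕ} (hf : f.natDegree = d) (hd : ¬ p ∣ d)
    {s q : ℕ} (hq : q = p ^ s) (hK : Fintype.card K = q * q)
    (hlarge : (d * p) ^ 2 + 3 * (d * p) + 1 < q) :
    p * (univ.filter fun x : K => ∃ y, y ^ p - y = f.eval x).card ≤
      (q - 1) + q * (q + 2 * (d * p)) := by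
  obtain ⟨r, ⟨b, hb, hrb⟩, hdeg, hr⟩ := exists_artinSchreier_auxiliary hf hd hq hK hlarge
  refine (Nat.mul_le_mul_left p ?_).trans (hdeg b hb)
  refine card_le_degree_of_subset_roots fun x hx => ?_
  obtain ⟨-, y, hy⟩ := mem_filter.1 hx
  rw [mem_roots hrb, IsRoot.def]
  let ι := ZMod.castHom (dvd_refl p) K
  have hι : ∀ c, ι c ^ p = ι c := fun c => by rw [← map_pow, ZMod.pow_card]
  have hzero : ∑ b ∈ range p, C ((r b).eval x) * X ^ b = 0 := by
    refine eq_zero_of_natDegree_lt_card_of_eval_eq_zero _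
      (show Function.Injective fun c => y + ι c from
        (add_right_injective y).comp ι.injective) (fun c => ?_) ?_
    · have h : (y + ι c) ^ p - (y + ι c) = f.eval x := by
        rw [add_pow_char, hι, ← hy]
        ring
      simpa [eval_finsetSum] using hr x _ h
    · rw [ZMod.card]
      refine lt_of_le_of_lt (natDegree_sum_le_of_forall_le (n := p - 1) _ _ fun i hi => ?_) ?_
      · exact (natDegree_C_mul_X_pow_le _ _).trans (Nat.le_sub_one_of_lt (mem_range.1 hi))
      · have := (Fact.out : p.Prime).pos
        omega
  have h := congrArg (coeff · b) hzero
  simpa [finsetSum_coeff, coeff_C_mul, coeff_X_pow, hb] using h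

open Polynomial in
theorem norm_sum_addChar_eval_le_of_frobenius {K : Type*} [Field K] [Fintype K]
    {p : ℕ} [Fact p.Prime] [CharP K p] {f : K[X]} {d : ℕ} (hf : f.natDegree = d) (hd : ¬ p ∣ d)
    {s q : ℕ} (hq : q = p ^ s) (hK : Fintype.card K = q * q)
    (hlarge : (d * p) ^ 2 + 3 * (d * p) + 1 < q) {ψ : AddChar K ℂ} (hψ : ψ ≠ 1)
    (hψp : ∀ y, ψ (y ^ p) = ψ y) :
    ‖∑ x, ψ (f.eval x)‖ ≤ (2 * (d * p) + 1 : ℝ) * q := by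
  classical
  have hp0 : 0 < p := (Fact.out : p.Prime).pos
  let φ : K →+ K := (frobenius K p).toAddMonoidHom - AddMonoidHom.id K
  have hφ : ∀ y, φ y = y ^ p - y := fun y => rfl
  let H : Finset K := univ.image φ
  have hH : ∀ η ∈ H, ψ η = 1 := by
    intro η hη
    obtain ⟨y, -, rfl⟩ := mem_image.1 hη
    rw [hφ, AddChar.map_sub_eq_div, hψp, div_self (ψ.val_isUnit y).ne_zero]
  have hHcard : Fintype.card K ≤ p * H.card := by
    refine card_le_mul_card_image univ p fun η hη => ?_
    obtain ⟨y₀, -, rfl⟩ := mem_image.1 hη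
    have hdeg : (X ^ p - X - C (φ y₀) : K[X]).natDegree = p := by
      rw [natDegree_sub_C, FiniteField.X_pow_card_sub_X_natDegree_eq K (Fact.out : p.Prime).one_lt]
    refine (card_le_degree_of_subset_roots fun y hy => ?_).trans hdeg.le
    rw [mem_roots (ne_zero_of_natDegree_gt (hp0.trans_eq hdeg.symm)), IsRoot.def]
    have hy : φ y = φ y₀ := (mem_filter.1 hy).2
    simp [← hy, hφ]
  let h : K → ℕ := fun β => (univ.filter fun x => f.eval x - β ∈ H).card
  have hh : ∀ β, p * h β ≤ (q - 1) + q * (q + 2 * (d * p)) := by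
    intro β
    have := mul_card_filter_exists_pow_sub_self_eq_le (f := f - C β) (by rwa [natDegree_sub_C]) hd
      hq hK hlarge
    convert this using 4 with x
    simp [H, hφ]
  have hinner : ∀ (g : K → ℂ), (∀ x, ∀ η ∈ H, g (x - η) = g x) →
      ∑ β, g β * h β = H.card * ∑ x, g (f.eval x) := by
    intro g hg
    calc ∑ β, g β * h β = ∑ x, ∑ β, if f.eval x - β ∈ H then g β else 0 := by
          rw [sum_comm]
          refine sum_congr rfl fun β _ => ?_
          rw [← sum_filter, sum_const, nsmul_eq_mul, mul_comm]
      _ = ∑ x, ∑ η ∈ H, g (f.eval x) := by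
          refine sum_congr rfl fun x _ => ?_
          rw [← (Equiv.subLeft (f.eval x)).sum_comp]
          simp only [Equiv.subLeft_apply, sub_sub_cancel]
          rw [← sum_filter, filter_mem_eq_inter, univ_inter]
          exact sum_congr rfl fun η hη => hg _ _ hη
      _ = _ := by simp [mul_sum]
  have h1 := hinner ψ fun x η hη => by
    rw [AddChar.map_sub_eq_div, hH η hη, div_one]
  have h2 := hinner 1 fun x η hη => rfl
  set S := ∑ x, ψ (f.eval x)
  have h3 : (∑ β, (h β : ℝ)) = H.card * Fintype.card K := by
    have : ((∑ β, (h β : ℝ) : ℝ) : ℂ) = (H.card * Fintype.card K : ℝ) := by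
      simpa using h2
    exact_mod_cast this
  have h4 : ∑ β, ψ β = 0 := (AddChar.sum_eq_zero_iff_ne_zero).2 hψ
  have hq0 : 0 < q := by omega
  set B : ℝ := q * q + (2 * (d * p) + 1) * q with hB
  have hhB : ∀ β, (p : ℝ) * h β ≤ B := by
    intro β
    have : ((p * h β : ℕ) : ℝ) ≤ ((q + q * (q + 2 * (d * p)) : ℕ) : ℝ) :=
      Nat.cast_le.2 ((hh β).trans (by omega))
    push_cast at this
    rw [hB]
    linarith
  have h5 : (p * H.card : ℝ) * ‖S‖ ≤ Fintype.card K * (B - p * H.card) := by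
    have e : (p * H.card : ℂ) * S = ∑ β, ψ β * ((p * h β - B : ℝ) : ℂ) := by
      push_cast
      simp only [mul_sub, sum_sub_distrib, ← sum_mul, h4, zero_mul, sub_zero]
      rw [mul_assoc, ← h1, mul_sum]
      exact sum_congr rfl fun β _ => by ring
    calc (p * H.card : ℝ) * ‖S‖ = ‖(p * H.card : ℂ) * S‖ := by simp
      _ ≤ ∑ β, ‖ψ β * ((p * h β - B : ℝ) : ℂ)‖ := by rw [e]; exact norm_sum_le _ _
      _ = ∑ β, (B - p * h β) := sum_congr rfl fun β _ => by
          rw [norm_mul, AddChar.norm_apply, one_mul, Complex.norm_real, Real.norm_eq_abs,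
            abs_of_nonpos (by linarith [hhB β]), neg_sub]
      _ = _ := by
          rw [sum_sub_distrib, ← mul_sum, h3]
          simp only [sum_const, card_univ, nsmul_eq_mul]
          ring
  have hHc : (Fintype.card K : ℝ) ≤ p * H.card := by exact_mod_cast hHcard
  have hKR : (Fintype.card K : ℝ) = q * q := by exact_mod_cast hK
  have hqR : (0 : ℝ) < q := by exact_mod_cast hq0
  have hpos : (0 : ℝ) < p * H.card := lt_of_lt_of_le (by rw [hKR]; positivity) hHc
  have h6 : (0 : ℝ) ≤ (2 * (d * p) + 1) * q := by positivity
  refine le_of_mul_le_mul_left (h5.trans ?_) hpos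
  calc (Fintype.card K : ℝ) * (B - p * H.card) ≤ Fintype.card K * ((2 * (d * p) + 1) * q) := by
        gcongr
        linarith
    _ ≤ _ := by gcongr

open Polynomial Classical in
/-- The monic polynomials of degree `n` over a finite field. -/
noncomputable def monicsOfDegree (F : Type*) [Field F] [Fintype F] (n : ℕ) : Finset F[X] :=
  univ.image fun a : Fin n → F => X ^ n + ∑ i : Fin n, C (a i) * X ^ (i : ℕ)

open Polynomial in
theorem mem_monicsOfDegree {F : Type*} [Field F] [Fintype F] {n : ℕ} {g : F[X]} :
    g ∈ monicsOfDegree F n ↔ g.Monic ∧ g.natDegree = n := by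
  classical
  rw [monicsOfDegree, mem_image]
  constructor
  · rintro ⟨a, -, rfl⟩
    exact ⟨monic_X_pow_add (degree_sum_fin_lt a),
      natDegree_eq_of_degree_eq_some <| by
        rw [degree_add_eq_left_of_degree_lt, degree_X_pow]
        rw [degree_X_pow]
        exact degree_sum_fin_lt a⟩
  · rintro ⟨hg, rfl⟩
    refine ⟨fun i => g.coeff i, mem_univ _, ?_⟩
    rw [Fin.sum_univ_eq_sum_range (fun i => C (g.coeff i) * X ^ i)]
    exact hg.as_sum.symm

open Polynomial Classical in
/-- The monic irreducible polynomials of degree at most `n` over a finite field. -/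
noncomputable def monicIrreduciblesOfDegreeLE (F : Type*) [Field F] [Fintype F] (n : ℕ) :
    Finset F[X] :=
  ((range (n + 1)).biUnion (monicsOfDegree F)).filter Irreducible

open Polynomial in
theorem mem_monicIrreduciblesOfDegreeLE {F : Type*} [Field F] [Fintype F] {n : ℕ} {P : F[X]} :
    P ∈ monicIrreduciblesOfDegreeLE F n ↔ P.Monic ∧ P.natDegree ≤ n ∧ Irreducible P := by
  simp only [monicIrreduciblesOfDegreeLE, mem_filter, mem_biUnion, mem_range, mem_monicsOfDegree]
  constructor
  · rintro ⟨⟨m, hm, h1, rfl⟩, h2⟩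
    exact ⟨h1, by omega, h2⟩
  · rintro ⟨h1, h2, h3⟩
    exact ⟨⟨_, by omega, h1, rfl⟩, h3⟩

open Polynomial Classical in
theorem card_filter_pow_dvd {F : Type*} [Field F] {n : ℕ} {g P : F[X]}
    (hg : g.Monic) (hn : g.natDegree = n) (hP : P.Monic) (hPi : Irreducible P) :
    ((Icc 1 n).filter fun m => P.natDegree ∣ m ∧ P ^ (m / P.natDegree) ∣ g).card =
      (UniqueFactorizationMonoid.normalizedFactors g).count P := by
  have hP0 : 0 < P.natDegree := hPi.natDegree_pos
  have hdvd : ∀ j, P ^ j ∣ g ↔ j ≤ (UniqueFactorizationMonoid.normalizedFactors g).count P := by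
    intro j
    rw [pow_dvd_iff_le_emultiplicity,
      UniqueFactorizationMonoid.emultiplicity_eq_count_normalizedFactors hPi hg.ne_zero,
      hP.normalize_eq_self, Nat.cast_le]
  have himage : (Icc 1 n).filter (fun m => P.natDegree ∣ m ∧ P ^ (m / P.natDegree) ∣ g) =
      (Icc 1 ((UniqueFactorizationMonoid.normalizedFactors g).count P)).image
        (P.natDegree * ·) := by
    ext m
    simp only [mem_filter, mem_image, mem_Icc]
    constructor
    · rintro ⟨⟨h1, -⟩, ⟨j, rfl⟩, h3⟩
      rw [Nat.mul_div_cancel_left _ hP0, hdvd] at h3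
      exact ⟨j, ⟨Nat.pos_of_mul_pos_left h1, h3⟩, rfl⟩
    · rintro ⟨j, ⟨h1, h2⟩, rfl⟩
      rw [← hdvd] at h2
      refine ⟨⟨Nat.mul_pos hP0 h1, ?_⟩, dvd_mul_right _ _, ?_⟩
      · have := natDegree_le_of_dvd h2 hg.ne_zero
        rwa [hP.natDegree_pow, hn, mul_comm] at this
      · rwa [Nat.mul_div_cancel_left _ hP0]
  rw [himage, card_image_of_injective _ fun a b h => Nat.eq_of_mul_eq_mul_left hP0 h, Nat.card_Icc,
    Nat.add_sub_cancel]

open Polynomial Classical in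
theorem sum_natDegree_mul_card_filter_pow_dvd {F : Type*} [Field F] [Fintype F] {n : ℕ} {g : F[X]} (hg : g.Monic) (hn : g.natDegree = n) :
    ∑ P ∈ monicIrreduciblesOfDegreeLE F n, P.natDegree *
      ((Icc 1 n).filter fun m => P.natDegree ∣ m ∧ P ^ (m / P.natDegree) ∣ g).card = n := by
  have hprod := UniqueFactorizationMonoid.prod_normalizedFactors_eq hg.ne_zero
  rw [hg.normalize_eq_self] at hprod
  have hmem : ∀ P ∈ UniqueFactorizationMonoid.normalizedFactors g, P.Monic := fun P hP => by
    rw [← UniqueFactorizationMonoid.normalize_normalized_factor P hP]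
    exact monic_normalize
      (UniqueFactorizationMonoid.irreducible_of_normalized_factor P hP).ne_zero
  calc _ = ∑ P ∈ monicIrreduciblesOfDegreeLE F n,
        (UniqueFactorizationMonoid.normalizedFactors g).count P * P.natDegree := by
        refine sum_congr rfl fun P hP => ?_
        obtain ⟨h1, -, h2⟩ := mem_monicIrreduciblesOfDegreeLE.1 hP
        rw [card_filter_pow_dvd hg hn h1 h2, mul_comm]
    _ = ((UniqueFactorizationMonoid.normalizedFactors g).map natDegree).sum := by
        rw [sum_multiset_map_count]
        simp only [smul_eq_mul]
        symm
        refine sum_subset (fun P hP => ?_) fun P _ hP => ?_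
        · rw [Multiset.mem_toFinset] at hP
          exact mem_monicIrreduciblesOfDegreeLE.2 ⟨hmem P hP,
            hn ▸ natDegree_le_of_dvd
              (UniqueFactorizationMonoid.dvd_of_mem_normalizedFactors hP) hg.ne_zero,
            UniqueFactorizationMonoid.irreducible_of_normalized_factor P hP⟩
        · rw [Multiset.mem_toFinset, ← Multiset.count_eq_zero] at hP
          rw [hP, zero_mul]
    _ = n := by
        rw [← natDegree_multiset_prod_of_monic _ hmem, hprod, hn]

open Polynomial in
/-- The logarithmic derivative of the `L`-function of a completely multiplicative function on
monic polynomials, compared coefficientwise. -/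
theorem natCast_mul_sum_monicsOfDegree {F : Type*} [Field F] [Fintype F] {χ : F[X] → ℂ}
    (hχ1 : χ 1 = 1)
    (hχ : ∀ g h : F[X], g.Monic → h.Monic → χ (g * h) = χ g * χ h) {S : ℕ → ℂ} {n : ℕ}
    (hS : ∀ m ∈ Icc 1 n, S m =
      ∑ P ∈ (monicIrreduciblesOfDegreeLE F n).filter (·.natDegree ∣ m),
        P.natDegree * χ P ^ (m / P.natDegree)) :
    n * ∑ g ∈ monicsOfDegree F n, χ g =
      ∑ m ∈ Icc 1 n, S m * ∑ g ∈ monicsOfDegree F (n - m), χ g := by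
  classical
  have hpow : ∀ (P : F[X]) j, P.Monic → χ (P ^ j) = χ P ^ j := fun P j hP => by
    induction j with
    | zero => simpa using hχ1
    | succ j ih => rw [pow_succ, hχ _ _ (hP.pow j) hP, ih, pow_succ]
  have hterm : ∀ m ∈ Icc 1 n, S m * ∑ g ∈ monicsOfDegree F (n - m), χ g =
      ∑ g ∈ monicsOfDegree F n, χ g * ∑ P ∈ monicIrreduciblesOfDegreeLE F n,
        if P.natDegree ∣ m ∧ P ^ (m / P.natDegree) ∣ g then (P.natDegree : ℂ) else 0 := by
    intro m hm
    obtain ⟨hm1, hmn⟩ := mem_Icc.1 hm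
    simp only [mul_sum]
    rw [sum_comm (s := monicsOfDegree F n), ← mul_sum, hS m hm, sum_mul, sum_filter]
    refine sum_congr rfl fun P hP => ?_
    obtain ⟨h1, -, h2⟩ := mem_monicIrreduciblesOfDegreeLE.1 hP
    split_ifs with hd
    · obtain ⟨j, rfl⟩ := hd
      have hj : P.natDegree * j / P.natDegree = j := Nat.mul_div_cancel_left _ h2.natDegree_pos
      simp only [hj, dvd_mul_right, true_and, mul_ite, mul_zero]
      rw [← sum_filter, mul_assoc, mul_sum, mul_sum]
      have hj' : (P ^ j).natDegree = P.natDegree * j := by rw [h1.natDegree_pow, mul_comm]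
      refine sum_bij (fun h _ => P ^ j * h) (fun h hh => ?_) (fun h _ h' _ e => ?_)
        (fun g hg => ?_) fun h hh => ?_
      · obtain ⟨h3, h4⟩ := mem_monicsOfDegree.1 hh
        refine mem_filter.2 ⟨mem_monicsOfDegree.2 ⟨(h1.pow j).mul h3, ?_⟩, dvd_mul_right _ _⟩
        rw [(h1.pow j).natDegree_mul h3, h4, hj']
        omega
      · exact mul_left_cancel₀ (h1.pow j).ne_zero e
      · obtain ⟨hg, h, rfl⟩ := mem_filter.1 hg
        obtain ⟨h3, h4⟩ := mem_monicsOfDegree.1 hg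
        have h5 := (h1.pow j).of_mul_monic_left h3
        refine ⟨h, mem_monicsOfDegree.2 ⟨h5, ?_⟩, rfl⟩
        rw [(h1.pow j).natDegree_mul h5, hj'] at h4
        omega
      · rw [hχ _ _ (h1.pow j) (mem_monicsOfDegree.1 hh).1, hpow _ _ h1]
        ring
    · simp [hd]
  rw [sum_congr rfl hterm, sum_comm, mul_sum]
  refine sum_congr rfl fun g hg => ?_
  obtain ⟨h1, h2⟩ := mem_monicsOfDegree.1 hg
  rw [← mul_sum, sum_comm, mul_comm]
  congr 1
  conv_lhs => rw [← sum_natDegree_mul_card_filter_pow_dvd h1 h2]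
  push_cast
  refine sum_congr rfl fun P _ => ?_
  rw [← sum_filter, sum_const, nsmul_eq_mul, mul_comm]

theorem sum_pow_sub_sum_pow {R : Type*} [CommRing R] {s t : Multiset R} {k : ℕ} (hk : 0 < k)
    (h : ∀ i < k, s.esymm i = t.esymm i) :
    (t.map (· ^ k)).sum - (s.map (· ^ k)).sum = (-1) ^ (k + 1) * (k * (t.esymm k - s.esymm k)) := by
  induction k using Nat.strong_induction_on with
  | _ k ih =>
    obtain ⟨k, rfl⟩ : ∃ l, k = l + 1 := ⟨k - 1, by omega⟩
    have hzero : ∀ s : Multiset R, s.esymm 0 = 1 := fun s => by simp [Multiset.esymm]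
    have hs := mul_esymm_eq_sum_range s (k + 1)
    have ht := mul_esymm_eq_sum_range t (k + 1)
    rw [sum_range_succ'] at hs ht
    have hrest : ∑ i ∈ range k, (-1) ^ (k + 1 + (i + 1) + 1) * s.esymm (i + 1) *
          (s.map (· ^ (k + 1 - (i + 1)))).sum =
        ∑ i ∈ range k, (-1) ^ (k + 1 + (i + 1) + 1) * t.esymm (i + 1) *
          (t.map (· ^ (k + 1 - (i + 1)))).sum := by
      refine sum_congr rfl fun i hi => ?_
      have hi := mem_range.1 hi
      have h1 := ih (k + 1 - (i + 1)) (by omega) (by omega) fun j hj => h j (by omega)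
      rw [h _ (show k + 1 - (i + 1) < k + 1 by omega), sub_self, mul_zero, mul_zero] at h1
      rw [h _ (show i + 1 < k + 1 by omega), sub_eq_zero.1 h1]
    rw [mul_sub, hs, ht, hrest]
    have hsq : ((-1 : R) ^ (k + 1 + 1)) * (-1) ^ (k + 1 + 1) = 1 := by
      rw [← mul_pow, neg_one_mul, neg_neg, one_pow]
    simp only [hzero, mul_one, add_zero, Nat.sub_zero]
    linear_combination ((s.map (· ^ (k + 1))).sum - (t.map (· ^ (k + 1))).sum) * hsq

open Polynomial in
theorem esymm_aroots {F E : Type*} [Field F] [Field E] [IsAlgClosed E] [Algebra F E] {g : F[X]}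
    (hg : g.Monic) {i : ℕ} (hi : i ≤ g.natDegree) :
    (g.aroots E).esymm i = (-1) ^ i * algebraMap F E (g.coeff (g.natDegree - i)) := by
  have h := coeff_eq_esymm_roots_of_card (p := g.map (algebraMap F E))
    (IsAlgClosed.card_aroots_eq_natDegree.trans (natDegree_map _).symm) (k := g.natDegree - i)
    (by rw [natDegree_map]; omega)
  rw [natDegree_map, Nat.sub_sub_self hi, (hg.map _).leadingCoeff, one_mul, coeff_map] at h
  rw [h, ← mul_assoc, ← mul_pow, neg_one_mul, neg_neg, one_pow, one_mul]

open Polynomial in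
theorem sum_map_aeval {F E : Type*} [Field F] [Field E] [Algebra F E] (f : F[X])
    (s : Multiset E) :
    (s.map fun x => aeval x f).sum =
      ∑ i ∈ range (f.natDegree + 1), algebraMap F E (f.coeff i) * (s.map (· ^ i)).sum := by
  induction s using Multiset.induction_on with
  | empty => simp
  | cons x s ih =>
    simp only [Multiset.map_cons, Multiset.sum_cons, ih, mul_add, sum_add_distrib]
    rw [aeval_eq_sum_range]
    simp only [Algebra.smul_def]

open Polynomial in
theorem sum_map_aeval_aroots_add_C_mul_X_pow {F E : Type*} [Field F] [Field E] [IsAlgClosed E]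
    [Algebra F E] {f g : F[X]} (hf : 0 < f.natDegree) (hg : g.Monic)
    (hfg : f.natDegree ≤ g.natDegree) (u : F) :
    (((g + C u * X ^ (g.natDegree - f.natDegree)).aroots E).map fun x => aeval x f).sum =
      ((g.aroots E).map fun x => aeval x f).sum +
        algebraMap F E (-(f.natDegree * f.leadingCoeff * u)) := by
  set d := f.natDegree with hd
  set n := g.natDegree with hn
  set g' := g + C u * X ^ (n - d)
  have hlt : (C u * X ^ (n - d)).degree < g.degree := by
    rw [degree_eq_natDegree hg.ne_zero]
    exact (degree_C_mul_X_pow_le _ _).trans_lt (by exact_mod_cast (by omega : n - d < n))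
  have hg' : g'.Monic := hg.add_of_left hlt
  have hn' : g'.natDegree = n := natDegree_eq_of_degree_eq (degree_add_eq_left_of_degree_lt hlt)
  have hcoeff : ∀ i ≤ n, (g'.aroots E).esymm i - (g.aroots E).esymm i =
      if i = d then (-1) ^ d * algebraMap F E u else 0 := by
    intro i hi
    rw [esymm_aroots hg' (hi.trans_eq hn'.symm), esymm_aroots hg hi, hn', ← hn, ← mul_sub,
      ← map_sub]
    simp only [g', coeff_add, coeff_C_mul, coeff_X_pow, add_sub_cancel_left]
    by_cases h : i = d
    · simp [h]
    · rw [if_neg h, if_neg (by omega)]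
      simp
  have hlow : ∀ i < d, (g.aroots E).esymm i = (g'.aroots E).esymm i := by
    intro i hi
    have := hcoeff i (by omega)
    rw [if_neg hi.ne, sub_eq_zero] at this
    exact this.symm
  have hp : ∀ i < d, ((g'.aroots E).map (· ^ i)).sum = ((g.aroots E).map (· ^ i)).sum := by
    intro i hi
    rcases Nat.eq_zero_or_pos i with rfl | h0
    · simp only [pow_zero, Multiset.map_const', Multiset.sum_replicate, nsmul_eq_mul, mul_one]
      rw [IsAlgClosed.card_aroots_eq_natDegree, IsAlgClosed.card_aroots_eq_natDegree, hn', ← hn]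
    · have h1 := sum_pow_sub_sum_pow h0 fun j hj => hlow j (hj.trans hi)
      rwa [hlow i hi, sub_self, mul_zero, mul_zero, sub_eq_zero] at h1
  have htop := sum_pow_sub_sum_pow hf hlow
  rw [hcoeff d hfg, if_pos rfl] at htop
  rw [sum_map_aeval, sum_map_aeval, ← hd, sum_range_succ, sum_range_succ,
    sum_congr rfl fun i hi => by rw [hp i (mem_range.1 hi)], add_assoc]
  congr 1
  rw [sub_eq_iff_eq_add'.1 htop, leadingCoeff, ← hd]
  have hsq : ((-1 : E) ^ d) * (-1) ^ d = 1 := by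
    rw [← mul_pow, neg_one_mul, neg_neg, one_pow]
  simp only [map_neg, map_mul, map_natCast]
  linear_combination (-algebraMap F E (f.coeff d) * d * algebraMap F E u) * hsq

open Polynomial in
/-- The value at `g` of `ψ` applied to the sum of `f` over the roots of `g`, where `π` descends the
sum to the ground field. -/
noncomputable def rootSumChar {F E : Type*} [Field F] [Field E] [Algebra F E] (f : F[X])
    (ψ : AddChar F ℂ) (π : E →ₗ[F] F) (g : F[X]) : ℂ :=
  ψ (π ((g.aroots E).map fun x => aeval x f).sum)

open Polynomial in
theorem rootSumChar_one {F E : Type*} [Field F] [Field E] [Algebra F E] (f : F[X])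
    (ψ : AddChar F ℂ) (π : E →ₗ[F] F) : rootSumChar f ψ π 1 = 1 := by
  simp [rootSumChar]

open Polynomial in
theorem rootSumChar_mul {F E : Type*} [Field F] [Field E] [Algebra F E] (f : F[X])
    (ψ : AddChar F ℂ) (π : E →ₗ[F] F) {g h : F[X]} (hg : g.Monic) (hh : h.Monic) :
    rootSumChar f ψ π (g * h) = rootSumChar f ψ π g * rootSumChar f ψ π h := by
  rw [rootSumChar, aroots_mul (hg.mul hh).ne_zero, Multiset.map_add, Multiset.sum_add, map_add,
    AddChar.map_add_eq_mul]
  rfl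

open Polynomial in
theorem sum_monicsOfDegree_zero {F E : Type*} [Field F] [Fintype F] [Field E] [Algebra F E]
    (f : F[X]) (ψ : AddChar F ℂ) (π : E →ₗ[F] F) :
    ∑ g ∈ monicsOfDegree F 0, rootSumChar f ψ π g = 1 := by
  have h : monicsOfDegree F 0 = {1} := by
    ext g
    rw [mem_monicsOfDegree, mem_singleton]
    exact ⟨fun h => h.1.natDegree_eq_zero.1 h.2, fun h => h ▸ ⟨monic_one, natDegree_one⟩⟩
  rw [h, sum_singleton, rootSumChar_one]

open Polynomial in
theorem sum_monicsOfDegree_eq_zero {F E : Type*} [Field F] [Fintype F] [Field E] [IsAlgClosed E]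
    [Algebra F E] {p : ℕ} [CharP F p] {f : F[X]} (hf : ¬ p ∣ f.natDegree) {ψ : AddChar F ℂ}
    (hψ : ψ ≠ 1) {π : E →ₗ[F] F} (hπ : ∀ u, π (algebraMap F E u) = u) {n : ℕ}
    (hn : f.natDegree ≤ n) : ∑ g ∈ monicsOfDegree F n, rootSumChar f ψ π g = 0 := by
  have hd0 : (f.natDegree : F) ≠ 0 := fun h => hf ((CharP.cast_eq_zero_iff F p _).1 h)
  have hd : 0 < f.natDegree := Nat.pos_of_ne_zero fun h => hf (h ▸ dvd_zero _)
  have hlc : f.leadingCoeff ≠ 0 := leadingCoeff_ne_zero.2 (ne_zero_of_natDegree_gt hd)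
  obtain ⟨w, hw⟩ : ∃ w, ψ w ≠ 1 := by
    by_contra! h
    exact hψ (DFunLike.ext _ _ h)
  let u := -(w / (f.natDegree * f.leadingCoeff))
  have hu : -(f.natDegree * f.leadingCoeff * u) = w := by
    simp only [u]
    field_simp
  have hshift : ∀ g ∈ monicsOfDegree F n, ∀ v : F,
      g + C v * X ^ (n - f.natDegree) ∈ monicsOfDegree F n := by
    intro g hg v
    obtain ⟨h1, h2⟩ := mem_monicsOfDegree.1 hg
    have hlt : (C v * X ^ (n - f.natDegree)).degree < g.degree := by
      rw [degree_eq_natDegree h1.ne_zero, h2]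
      exact (degree_C_mul_X_pow_le _ _).trans_lt (by exact_mod_cast (by omega))
    exact mem_monicsOfDegree.2 ⟨h1.add_of_left hlt,
      (natDegree_eq_of_degree_eq (degree_add_eq_left_of_degree_lt hlt)).trans h2⟩
  have hval : ∀ g ∈ monicsOfDegree F n, rootSumChar f ψ π (g + C u * X ^ (n - f.natDegree)) =
      rootSumChar f ψ π g * ψ w := by
    intro g hg
    obtain ⟨h1, rfl⟩ := mem_monicsOfDegree.1 hg
    rw [rootSumChar, sum_map_aeval_aroots_add_C_mul_X_pow hd h1 hn, hu, map_add, hπ,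
      AddChar.map_add_eq_mul]
    rfl
  have hsum : ∑ g ∈ monicsOfDegree F n, rootSumChar f ψ π g =
      (∑ g ∈ monicsOfDegree F n, rootSumChar f ψ π g) * ψ w := by
    rw [sum_mul, ← sum_congr rfl hval]
    refine sum_nbij' (fun g => g + C (-u) * X ^ (n - f.natDegree))
      (fun g => g + C u * X ^ (n - f.natDegree)) (fun g hg => hshift g hg _)
      (fun g hg => hshift g hg _) ?_ ?_ ?_ <;> intro g _ <;> simp
  by_contra h
  exact hw (mul_left_cancel₀ h (by rw [← hsum, mul_one]))

open Polynomial IntermediateField in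
theorem algebraMap_trace_aeval {F K E : Type*} [Field F] [Field K] [Algebra F K]
    [FiniteDimensional F K] [Algebra.IsSeparable F K] [Field E] [IsAlgClosed E] [Algebra F E]
    (f : F[X]) (x : K) :
    algebraMap F E (Algebra.trace F K (aeval x f)) =
      Module.finrank F⟮x⟯ K • (((minpoly F x).aroots E).map fun y => aeval y f).sum := by
  classical
  have hx : IsIntegral F x := Algebra.IsIntegral.isIntegral x
  have hgen : aeval x f = algebraMap F⟮x⟯ K (aeval (AdjoinSimple.gen F x) f) := by
    rw [← aeval_algebraMap_apply, AdjoinSimple.algebraMap_gen]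
  rw [hgen, ← Algebra.trace_trace (S := F⟮x⟯), Algebra.trace_algebraMap, map_nsmul, map_nsmul]
  congr 1
  have : Algebra.IsSeparable F F⟮x⟯ := Algebra.isSeparable_tower_bot_of_isSeparable F F⟮x⟯ K
  rw [trace_eq_sum_embeddings E]
  simp only [← aeval_algHom_apply]
  let pb := adjoin.powerBasis hx
  have hpb : minpoly F pb.gen = minpoly F x := by
    rw [adjoin.powerBasis_gen hx, minpoly_gen]
  have hroots : ((minpoly F x).aroots E).Nodup :=
    nodup_roots ((separable_map _).2 (Algebra.IsSeparable.isSeparable F x))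
  rw [Fintype.sum_equiv pb.liftEquiv' (fun σ => aeval (σ (AdjoinSimple.gen F x)) f)
      (fun y => aeval (y : E) f) fun σ => by
        rw [PowerBasis.liftEquiv'_apply_coe, adjoin.powerBasis_gen hx],
    sum_mem_multiset _ _ (fun y => aeval y f) fun _ => rfl, sum_eq_multiset_sum,
    Multiset.toFinset_val, Multiset.dedup_eq_self.2 (hpb ▸ hroots), hpb]

open Polynomial in
theorem card_filter_minpoly_eq {F K : Type*} [Field F] [Fintype F] [Field K] [Fintype K]
    [DecidableEq F[X]] [Algebra F K] {P : F[X]} (hP : P.Monic) (hPi : Irreducible P)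
    (hdvd : P.natDegree ∣ Module.finrank F K) :
    (univ.filter fun x : K => minpoly F x = P).card = P.natDegree := by
  classical
  have hsplit : (P.map (algebraMap F K)).Splits := by
    have h1 := (hPi.natDegree_dvd_iff_dvd_X_pow_card_pow_sub_X).1 hdvd
    rw [← Module.natCard_eq_pow_finrank] at h1
    refine splits_X_pow_nat_card_sub_X.of_dvd
      (FiniteField.X_pow_card_sub_X_ne_zero K Finite.one_lt_card) ?_
    simpa using Polynomial.map_dvd (algebraMap F K) h1
  rw [← card_rootSet_eq_natDegree (PerfectField.separable_of_irreducible hPi) hsplit,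
    ← Set.toFinset_card]
  congr 1
  ext x
  simp only [mem_filter, mem_univ, true_and, Set.mem_toFinset, mem_rootSet]
  constructor
  · rintro rfl
    exact ⟨hP.ne_zero, minpoly.aeval F x⟩
  · rintro ⟨-, h⟩
    exact (minpoly.eq_of_irreducible_of_monic hPi h hP).symm

open Polynomial IntermediateField in
theorem sum_addChar_trace_aeval {F K E : Type*} [Field F] [Fintype F] [Field K] [Fintype K]
    [Algebra F K] [Field E] [IsAlgClosed E] [Algebra F E] (f : F[X]) (ψ : AddChar F ℂ)
    {π : E →ₗ[F] F} (hπ : ∀ u, π (algebraMap F E u) = u) {m n : ℕ}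
    (hm : Module.finrank F K = m) (hmn : m ≤ n) :
    ∑ x : K, ψ (Algebra.trace F K (aeval x f)) =
      ∑ P ∈ (monicIrreduciblesOfDegreeLE F n).filter (·.natDegree ∣ m),
        P.natDegree * rootSumChar f ψ π P ^ (m / P.natDegree) := by
  classical
  have hint : ∀ x : K, IsIntegral F x := fun x => Algebra.IsIntegral.isIntegral x
  have hfin : ∀ x : K, (minpoly F x).natDegree * Module.finrank F⟮x⟯ K = m := fun x => by
    rw [← adjoin.finrank (hint x), ← hm, Module.finrank_mul_finrank]
  have hm0 : 0 < m := hm ▸ Module.finrank_pos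
  have hval : ∀ x : K, ψ (Algebra.trace F K (aeval x f)) =
      rootSumChar f ψ π (minpoly F x) ^ (m / (minpoly F x).natDegree) := by
    intro x
    rw [← hπ (Algebra.trace F K (aeval x f)), algebraMap_trace_aeval, map_nsmul,
      AddChar.map_nsmul_eq_pow, rootSumChar]
    congr 1
    rw [← hfin x, Nat.mul_div_cancel_left _ (minpoly.natDegree_pos (hint x))]
  have hmaps : ∀ x ∈ (univ : Finset K),
      minpoly F x ∈ (monicIrreduciblesOfDegreeLE F n).filter (·.natDegree ∣ m) := fun x _ =>
    mem_filter.2 ⟨mem_monicIrreduciblesOfDegreeLE.2 ⟨minpoly.monic (hint x),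
      (Nat.le_of_dvd hm0 ⟨_, (hfin x).symm⟩).trans hmn, minpoly.irreducible (hint x)⟩,
      ⟨_, (hfin x).symm⟩⟩
  rw [← sum_fiberwise_of_maps_to hmaps]
  refine sum_congr rfl fun P hP => ?_
  obtain ⟨hP, hdvd⟩ := mem_filter.1 hP
  obtain ⟨h1, -, h2⟩ := mem_monicIrreduciblesOfDegreeLE.1 hP
  calc _ = ∑ x ∈ univ.filter fun x : K => minpoly F x = P,
        rootSumChar f ψ π P ^ (m / P.natDegree) :=
        sum_congr rfl fun x hx => by rw [hval, (mem_filter.1 hx).2]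
    _ = _ := by rw [sum_const, card_filter_minpoly_eq h1 h2 (hm ▸ hdvd), nsmul_eq_mul]

open Polynomial in
theorem norm_le_of_norm_sum_pow_le {s : Multiset ℂ} {B R : ℝ} (hR : 0 < R) {N : ℕ}
    (h : ∀ m ≥ N, ‖(s.map (· ^ m)).sum‖ ≤ B * R ^ m) {β : ℂ} (hβ : β ∈ s) : ‖β‖ ≤ R := by
  classical
  by_contra! hlt
  let L : ℂ[X] := ∏ γ ∈ s.toFinset.erase β, (X - C γ)
  have hL : ∀ γ ∈ s.toFinset, γ ≠ β → L.eval γ = 0 := fun γ hγ hne => by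
    rw [eval_prod]
    exact prod_eq_zero (mem_erase.2 ⟨hne, hγ⟩) (by simp)
  have hLβ : L.eval β ≠ 0 := by
    rw [eval_prod, prod_ne_zero_iff]
    intro γ hγ
    rw [eval_sub, eval_X, eval_C, sub_ne_zero]
    exact (ne_of_mem_erase hγ).symm
  have hsum : ∀ m, (s.count β : ℂ) * (β ^ m * L.eval β) =
      ∑ j ∈ range (L.natDegree + 1), L.coeff j * (s.map (· ^ (m + j))).sum := by
    intro m
    simp only [sum_multiset_map_count, mul_sum]
    rw [sum_comm, sum_eq_single_of_mem β (Multiset.mem_toFinset.2 hβ)]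
    · rw [eval_eq_sum_range, mul_sum, mul_sum]
      refine sum_congr rfl fun j _ => ?_
      rw [nsmul_eq_mul]
      ring
    · intro γ hγ hne
      have := hL γ hγ hne
      rw [eval_eq_sum_range] at this
      calc _ = s.count γ * γ ^ m * ∑ j ∈ range (L.natDegree + 1), L.coeff j * γ ^ j := by
            rw [mul_sum]
            refine sum_congr rfl fun j _ => ?_
            rw [nsmul_eq_mul]
            ring
        _ = 0 := by rw [this, mul_zero]
  set a : ℝ := ‖(s.count β : ℂ)‖ * ‖L.eval β‖ with ha
  have ha0 : 0 < a := by
    refine mul_pos (norm_pos_iff.2 ?_) (norm_pos_iff.2 hLβ)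
    exact_mod_cast (Multiset.count_pos.2 hβ).ne'
  set b : ℝ := ∑ j ∈ range (L.natDegree + 1), ‖L.coeff j‖ * (B * R ^ j)
  have hbound : ∀ m ≥ N, a * ‖β‖ ^ m ≤ b * R ^ m := by
    intro m hm
    calc a * ‖β‖ ^ m = ‖(s.count β : ℂ) * (β ^ m * L.eval β)‖ := by
          rw [norm_mul, norm_mul, norm_pow]
          ring
      _ ≤ ∑ j ∈ range (L.natDegree + 1), ‖L.coeff j * (s.map (· ^ (m + j))).sum‖ := by
          rw [hsum]
          exact norm_sum_le _ _
      _ ≤ ∑ j ∈ range (L.natDegree + 1), ‖L.coeff j‖ * (B * R ^ (m + j)) := by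
          refine sum_le_sum fun j _ => ?_
          rw [norm_mul]
          exact mul_le_mul_of_nonneg_left (h _ (by omega)) (norm_nonneg _)
      _ = b * R ^ m := by
          rw [sum_mul]
          exact sum_congr rfl fun j _ => by ring
  have h1 : 1 < ‖β‖ / R := (one_lt_div hR).2 hlt
  obtain ⟨n, hn⟩ := pow_unbounded_of_one_lt (b / a) h1
  have h2 := hbound (n + N) (by omega)
  have h3 : (‖β‖ / R) ^ n ≤ (‖β‖ / R) ^ (n + N) := pow_le_pow_right₀ h1.le (by omega)
  have h4 : (‖β‖ / R) ^ (n + N) ≤ b / a := by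
    rw [div_pow, div_le_div_iff₀ (by positivity) ha0]
    linarith
  linarith

open Polynomial in
/-- If the power series `∑ c n * T ^ n` is a polynomial of degree less than `d` with logarithmic
derivative `∑ S m * T ^ m` (up to the factor `T`), then the growth of `S` bounds its first
coefficient. -/
theorem norm_le_of_newton {c S : ℕ → ℂ} {d : ℕ} (hd : 0 < d) (hc0 : c 0 = 1)
    (hc : ∀ n, d ≤ n → c n = 0)
    (hnewton : ∀ n : ℕ, n * c n = ∑ m ∈ Icc 1 n, S m * c (n - m))
    {B R : ℝ} (hR : 0 < R) {N : ℕ} (hS : ∀ m ≥ N, ‖S (2 * m)‖ ≤ B * R ^ m) :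
    ‖S 1‖ ≤ ((d : ℝ) - 1) * Real.sqrt R := by
  obtain ⟨d, rfl⟩ : ∃ e, d = e + 1 := ⟨d - 1, by omega⟩
  let M : ℂ[X] := ∑ n ∈ range (d + 1), C (c n) * X ^ (d - n)
  have hcoeff : ∀ i ≤ d, M.coeff (d - i) = c i := by
    intro i hi
    simp only [M, finsetSum_coeff, coeff_C_mul, coeff_X_pow]
    rw [sum_eq_single_of_mem i (mem_range.2 (by omega))]
    · simp
    · intro j hj hne
      have := mem_range.1 hj
      rw [if_neg (by omega), mul_zero]
  have hdeg : M.natDegree = d := by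
    refine le_antisymm (natDegree_sum_le_of_forall_le _ _ fun n _ =>
      (natDegree_C_mul_X_pow_le _ _).trans (Nat.sub_le _ _)) (le_natDegree_of_ne_zero ?_)
    have := hcoeff 0 (Nat.zero_le _)
    rw [Nat.sub_zero] at this
    rw [this, hc0]
    exact one_ne_zero
  have hlc : M.leadingCoeff = 1 := by
    rw [leadingCoeff, hdeg]
    simpa [hc0] using hcoeff 0 (Nat.zero_le _)
  have hcard : M.roots.card = M.natDegree := IsAlgClosed.card_roots_eq_natDegree
  have hesymm : ∀ i, M.roots.esymm i = (-1) ^ i * c i := by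
    intro i
    rcases le_or_gt i d with hi | hi
    · have h := coeff_eq_esymm_roots_of_card hcard (k := d - i) (by omega)
      rw [hdeg, Nat.sub_sub_self hi, hlc, one_mul, hcoeff i hi] at h
      rw [h, ← mul_assoc, ← mul_pow, neg_one_mul, neg_neg, one_pow, one_mul]
    · rw [hc i hi, mul_zero, Multiset.esymm, Multiset.powersetCard_eq_empty _ (by omega)]
      simp
  have hpsum : ∀ k, 0 < k → S k = -(M.roots.map (· ^ k)).sum := by
    intro k
    induction k using Nat.strong_induction_on with
    | _ k ih =>
      intro hk
      obtain ⟨k, rfl⟩ : ∃ l, k = l + 1 := ⟨k - 1, by omega⟩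
      have h1 := mul_esymm_eq_sum_range M.roots (k + 1)
      have h2 := hnewton (k + 1)
      have h3 : ∑ m ∈ Icc 1 (k + 1), S m * c (k + 1 - m) =
          ∑ i ∈ range (k + 1), c i * S (k + 1 - i) := by
        refine sum_nbij' (fun m => k + 1 - m) (fun i => k + 1 - i) ?_ ?_ ?_ ?_ ?_ <;> intro i hi <;>
          simp only [mem_Icc, mem_range] at hi ⊢
        · omega
        · omega
        · omega
        · omega
        · rw [Nat.sub_sub_self hi.2, mul_comm]
      have hsq : ((-1 : ℂ) ^ (k + 1)) * (-1) ^ (k + 1) = 1 := by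
        rw [← mul_pow, neg_one_mul, neg_neg, one_pow]
      have h4 : ((k + 1 : ℕ) : ℂ) * c (k + 1) =
          ∑ i ∈ range (k + 1), c i * -(M.roots.map (· ^ (k + 1 - i))).sum := by
        calc ((k + 1 : ℕ) : ℂ) * c (k + 1)
            = (-1) ^ (k + 1) * (((k + 1 : ℕ) : ℂ) * M.roots.esymm (k + 1)) := by
              rw [hesymm]
              linear_combination (-((k + 1 : ℕ) : ℂ) * c (k + 1)) * hsq
          _ = _ := by
              rw [h1, mul_sum]
              refine sum_congr rfl fun i _ => ?_
              have hsq' : ((-1 : ℂ) ^ i) * (-1) ^ i = 1 := by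
                rw [← mul_pow, neg_one_mul, neg_neg, one_pow]
              rw [hesymm, pow_add, pow_add]
              linear_combination (-c i * (M.roots.map (· ^ (k + 1 - i))).sum) *
                (hsq * (-1) ^ i * (-1) ^ i + hsq')
      rw [h2, h3, sum_range_succ', sum_range_succ'] at h4
      have h5 : ∑ i ∈ range k, c (i + 1) * S (k + 1 - (i + 1)) =
          ∑ i ∈ range k, c (i + 1) * -(M.roots.map (· ^ (k + 1 - (i + 1)))).sum :=
        sum_congr rfl fun i hi => by
          have := mem_range.1 hi
          rw [ih (k + 1 - (i + 1)) (by omega) (by omega)]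
      rw [h5] at h4
      simpa [hc0] using h4
  have hroot : ∀ α ∈ M.roots, ‖α‖ ≤ Real.sqrt R := by
    intro α hα
    refine Real.le_sqrt_of_sq_le ?_
    rw [← norm_pow]
    refine norm_le_of_norm_sum_pow_le (s := M.roots.map (· ^ 2)) hR (B := B) (N := N + 1)
      (fun m hm => ?_) (Multiset.mem_map_of_mem _ hα)
    have h := hS m (by omega)
    rw [hpsum _ (by omega), norm_neg] at h
    simpa only [Multiset.map_map, Function.comp_def, ← pow_mul] using h
  rw [hpsum 1 one_pos, norm_neg]
  simp only [pow_one, Multiset.map_id']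
  refine (norm_multiset_sum_le _).trans ((Multiset.sum_le_card_nsmul _ (Real.sqrt R) ?_).trans ?_)
  · intro x hx
    obtain ⟨α, hα, rfl⟩ := Multiset.mem_map.1 hx
    exact hroot α hα
  · rw [Multiset.card_map, hcard, hdeg, nsmul_eq_mul]
    push_cast
    rw [add_sub_cancel_right]

theorem FiniteField.trace_pow_char (F : Type*) {K : Type*} [Field F] [Field K] [Finite K]
    [Algebra F K] (p : ℕ) [Fact p.Prime] [CharP F p] (y : K) :
    Algebra.trace F K (y ^ p) = Algebra.trace F K y ^ p := by
  have := charP_of_injective_algebraMap (algebraMap F K).injective p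
  apply (algebraMap F K).injective
  rw [(algebraMap F K).map_pow, FiniteField.algebraMap_trace_eq_sum_pow, FiniteField.algebraMap_trace_eq_sum_pow,
    sum_pow_char]
  exact sum_congr rfl fun i _ => pow_right_comm _ _ _

open Polynomial in
theorem norm_sum_addChar_trace_aeval_le {F K : Type*} [Field F] [Fintype F] [Field K] [Fintype K]
    [Algebra F K] {p : ℕ} [Fact p.Prime] [CharP F p] {f : F[X]} (hf : ¬ p ∣ f.natDegree) {q : ℕ}
    (hK : Fintype.card K = q * q) (hq : ∃ s, q = p ^ s)
    (hlarge : (f.natDegree * p) ^ 2 + 3 * (f.natDegree * p) + 1 < q) {ψ : AddChar F ℂ}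
    (hψ : ψ ≠ 1) (hψp : ∀ y, ψ (y ^ p) = ψ y) :
    ‖∑ x : K, ψ (Algebra.trace F K (aeval x f))‖ ≤ (2 * (f.natDegree * p) + 1 : ℝ) * q := by
  obtain ⟨s, hs⟩ := hq
  have := charP_of_injective_algebraMap (algebraMap F K).injective p
  have h := norm_sum_addChar_eval_le_of_frobenius (f := f.map (algebraMap F K))
    (natDegree_map _) hf hs hK hlarge
    (ψ := ψ.compAddMonoidHom (Algebra.trace F K).toAddMonoidHom) ?_ ?_
  · simpa [aeval_def, eval_map] using h
  · intro h
    refine hψ (DFunLike.ext _ _ fun u => ?_)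
    obtain ⟨y, rfl⟩ := Algebra.trace_surjective F K u
    exact DFunLike.congr_fun h y
  · intro y
    change ψ (Algebra.trace F K (y ^ p)) = ψ (Algebra.trace F K y)
    rw [FiniteField.trace_pow_char, hψp]

open Polynomial in
theorem norm_sum_addChar_eval_le_of_pow_char {F : Type*} [Field F] [Fintype F] {p : ℕ}
    [Fact p.Prime] [CharP F p] {f : F[X]} (hf : ¬ p ∣ f.natDegree) {ψ : AddChar F ℂ} (hψ : ψ ≠ 1)
    (hψp : ∀ y, ψ (y ^ p) = ψ y) :
    ‖∑ x, ψ (f.eval x)‖ ≤ ((f.natDegree : ℝ) - 1) * Real.sqrt (Fintype.card F) := by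
  let E := AlgebraicClosure F
  obtain ⟨π, hπ⟩ := LinearMap.exists_leftInverse_of_injective (Algebra.linearMap F E)
    (LinearMap.ker_eq_bot.2 (algebraMap F E).injective)
  replace hπ : ∀ u, π (algebraMap F E u) = u := fun u => LinearMap.congr_fun hπ u
  have hd : 0 < f.natDegree := Nat.pos_of_ne_zero fun h => hf (h ▸ dvd_zero _)
  let S : ℕ → ℂ := fun m => ∑ P ∈ (monicIrreduciblesOfDegreeLE F m).filter (·.natDegree ∣ m),
    P.natDegree * rootSumChar f ψ π P ^ (m / P.natDegree)
  have hS : ∀ n, ∀ m ∈ Icc 1 n,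
      S m = ∑ P ∈ (monicIrreduciblesOfDegreeLE F n).filter (·.natDegree ∣ m),
        P.natDegree * rootSumChar f ψ π P ^ (m / P.natDegree) := by
    intro n m hm
    rw [mem_Icc] at hm
    refine sum_congr ?_ fun _ _ => rfl
    ext P
    simp only [mem_filter, mem_monicIrreduciblesOfDegreeLE]
    constructor
    · rintro ⟨⟨h1, h2, h3⟩, h4⟩
      exact ⟨⟨h1, h2.trans hm.2, h3⟩, h4⟩
    · rintro ⟨⟨h1, h2, h3⟩, h4⟩
      exact ⟨⟨h1, Nat.le_of_dvd hm.1 h4, h3⟩, h4⟩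
  have hS1 : S 1 = ∑ x, ψ (f.eval x) := by
    change ∑ P ∈ _, _ = _
    rw [← sum_addChar_trace_aeval (K := F) f ψ hπ (Module.finrank_self F) le_rfl]
    simp [Algebra.trace_self, coe_aeval_eq_eval]
  obtain ⟨r, -, hr⟩ := FiniteField.card F p
  have hF : 1 < Fintype.card F := Fintype.one_lt_card
  rw [← hS1]
  refine norm_le_of_newton (c := fun n => ∑ g ∈ monicsOfDegree F n, rootSumChar f ψ π g) hd
    (sum_monicsOfDegree_zero f ψ π) (fun n hn => sum_monicsOfDegree_eq_zero hf hψ hπ hn)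
    (fun n => natCast_mul_sum_monicsOfDegree (rootSumChar_one f ψ π)
      (fun g h hg hh => rootSumChar_mul f ψ π hg hh) (hS n))
    (B := 2 * (f.natDegree * p) + 1) (by positivity)
    (N := (f.natDegree * p) ^ 2 + 3 * (f.natDegree * p) + 1) fun m hm => ?_
  have : NeZero (2 * m) := ⟨by omega⟩
  let K := FiniteField.Extension F p (2 * m)
  have : Fintype K := Fintype.ofFinite K
  change ‖∑ P ∈ _, _‖ ≤ _
  rw [← sum_addChar_trace_aeval (K := K) f ψ hπ (FiniteField.finrank_extension F p (2 * m)) le_rfl]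
  have hK : Fintype.card K = Fintype.card F ^ m * Fintype.card F ^ m := by
    rw [Fintype.card_eq_nat_card, FiniteField.natCard_extension, Nat.card_eq_fintype_card,
      ← pow_add, two_mul]
  have h := norm_sum_addChar_trace_aeval_le (K := K) hf hK ⟨r * m, by rw [hr, pow_mul]⟩
    (lt_of_le_of_lt hm (Nat.lt_pow_self hF)) hψ hψp
  exact_mod_cast h

theorem exists_addChar_pow_char_eq (F : Type*) [Field F] [Finite F] (p : ℕ) [Fact p.Prime]
    [CharP F p] : ∃ ψ : AddChar F ℂ, ψ ≠ 1 ∧ ∀ y, ψ (y ^ p) = ψ y := by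
  let := ZMod.algebra F p
  refine ⟨ZMod.stdAddChar.compAddMonoidHom (Algebra.trace (ZMod p) F).toAddMonoidHom,
    fun h => ?_, fun y => ?_⟩
  · obtain ⟨y, hy⟩ := Algebra.trace_surjective (ZMod p) F 1
    have h1 : ZMod.stdAddChar (Algebra.trace (ZMod p) F y) = 1 := DFunLike.congr_fun h y
    rw [hy, ← AddChar.map_zero_eq_one (ZMod.stdAddChar (N := p)), ZMod.injective_stdAddChar.eq_iff]
      at h1
    exact one_ne_zero h1
  · change ZMod.stdAddChar (Algebra.trace (ZMod p) F (y ^ p)) =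
      ZMod.stdAddChar (Algebra.trace (ZMod p) F y)
    rw [FiniteField.trace_pow_char, ZMod.pow_card]

theorem AddChar.mulShift_surjective {F : Type*} [Field F] [Finite F] {ψ : AddChar F ℂ}
    (hψ : ψ ≠ 1) : Function.Surjective ψ.mulShift := by
  have := Fintype.ofFinite F
  exact ((Fintype.bijective_iff_injective_and_card _).2
    ⟨AddChar.to_mulShift_inj_of_isPrimitive (.of_ne_one hψ), AddChar.card_eq.symm⟩).2

/-- **Weil's bound** for additive character sums of polynomials over a finite field. -/
theorem norm_sum_addChar_eval_le {F : Type*} [Field F] [Fintype F] {p : ℕ} [Fact p.Prime]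
    [CharP F p] (f : Polynomial F) (hf : ¬ p ∣ f.natDegree) {ψ : AddChar F ℂ} (hψ : ψ ≠ 1) :
    ‖∑ x, ψ (f.eval x)‖ ≤ ((f.natDegree : ℝ) - 1) * Real.sqrt (Fintype.card F) := by
  obtain ⟨ψ₀, hψ₀, hψ₀p⟩ := exists_addChar_pow_char_eq F p
  obtain ⟨a, rfl⟩ := AddChar.mulShift_surjective hψ₀ ψ
  have ha : a ≠ 0 := by
    rintro rfl
    exact hψ (AddChar.mulShift_zero ψ₀)
  have hdeg := Polynomial.natDegree_C_mul (p := f) ha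
  have h := norm_sum_addChar_eval_le_of_pow_char (f := Polynomial.C a * f) (by rwa [hdeg]) hψ₀ hψ₀p
  simpa only [hdeg, Polynomial.eval_mul, Polynomial.eval_C, AddChar.mulShift_apply] using h

theorem addChar_map_sum {A M ι : Type*} [AddCommGroup A] [CommMonoid M] (ψ : AddChar A M)
    (s : Finset ι) (g : ι → A) : ψ (∑ x ∈ s, g x) = ∏ x ∈ s, ψ (g x) := by
  classical
  induction s using Finset.induction_on with
  | empty => simp
  | insert a s ha ih => rw [sum_insert ha, prod_insert ha, AddChar.map_add_eq_mul, ih]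

theorem pow_char_ne_one {F : Type*} [Field F] {p : ℕ} [CharP F p] {ψ : AddChar F ℂ} (hψ : ψ ≠ 1)
    {m : ℕ} (hm : ¬ p ∣ m) : ψ ^ m ≠ 1 := by
  obtain ⟨x, hx⟩ := AddChar.ne_one_iff.1 hψ
  have hm0 : (m : F) ≠ 0 := fun h => hm ((CharP.cast_eq_zero_iff F p m).1 h)
  intro h
  apply hx
  have h1 := DFunLike.congr_fun h ((m : F)⁻¹ * x)
  rwa [AddChar.pow_apply, ← AddChar.map_nsmul_eq_pow, nsmul_eq_mul, mul_inv_cancel_left₀ hm0,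
    AddChar.one_apply] at h1

theorem norm_sum_powersetCard_addChar_le {F : Type*} [Field F] [Fintype F] [DecidableEq F]
    {p : ℕ} [Fact p.Prime] [CharP F p] {f : Polynomial F} {W : ℝ}
    (hW : ∀ ψ : AddChar F ℂ, ψ ≠ 1 → ‖∑ x, ψ (f.eval x)‖ ≤ W) {D : Finset F} {c : ℕ}
    (hD : (D.card : ℝ) = Fintype.card F - c) (hWc : W + c ≤ D.card)
    (hX : 1 ≤ (D.card : ℝ) / p + ((p - 1 : ℝ) / p) * (W + c))
    {ψ : AddChar F ℂ} (hψ : ψ ≠ 1) (k : ℕ) :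
    ‖∑ S ∈ D.powersetCard k, ∏ x ∈ S, ψ (f.eval x)‖ ≤
      realChoose ((D.card : ℝ) / p + ((p - 1 : ℝ) / p) * (W + c) + k - 1) k := by
  have hp : p.Prime := Fact.out
  have hW0 : 0 ≤ W := (norm_nonneg _).trans (hW ψ hψ)
  refine le_realChoose_of_recurrence hp.pos (by positivity) hWc hX
    (E := fun k => ‖∑ S ∈ D.powersetCard k, ∏ x ∈ S, ψ (f.eval x)‖) (by simp) (fun n => ?_) k
  have h := mul_sum_powersetCard_prod D (fun x => ψ (f.eval x)) n
  have h' := congrArg norm h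
  rw [norm_mul, Complex.norm_natCast] at h'
  rw [h']
  refine (norm_sum_le _ _).trans (sum_le_sum fun i _ => ?_)
  rw [norm_mul, norm_mul, norm_pow, norm_neg, norm_one, one_pow, one_mul]
  refine mul_le_mul_of_nonneg_left ?_ (norm_nonneg _)
  have htriv : ∀ (χ : AddChar F ℂ) (s : Finset F), ‖∑ x ∈ s, χ (f.eval x)‖ ≤ s.card := by
    intro χ s
    refine (norm_sum_le _ _).trans ?_
    simp
  simp only [← AddChar.pow_apply]
  split_ifs with hdvd
  · exact htriv _ _
  · have h1 := hW _ (pow_char_ne_one (p := p) hψ hdvd)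
    have h2 := htriv (ψ ^ (n - i)) Dᶜ
    have hc : ((Dᶜ.card : ℕ) : ℝ) = c := by
      rw [card_compl, Nat.cast_sub (card_le_univ D), hD]
      ring
    have h3 := Finset.sum_add_sum_compl D fun x => (ψ ^ (n - i)) (f.eval x)
    rw [eq_sub_of_add_eq h3]
    refine (norm_sub_le _ _).trans ?_
    rw [hc] at h2
    exact add_le_add h1 h2

theorem card_mul_polySubsetSumCount {F : Type*} [Field F] [Fintype F] [DecidableEq F]
    (f : Polynomial F) (D : Finset F) (k : ℕ) (b : F) :
    (Fintype.card F : ℂ) * polySubsetSumCount D f k b =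
      ∑ ψ : AddChar F ℂ, ψ (-b) * ∑ S ∈ D.powersetCard k, ∏ x ∈ S, ψ (f.eval x) := by
  have h : ∀ S : Finset F, ∑ ψ : AddChar F ℂ, ψ (-b) * ∏ x ∈ S, ψ (f.eval x) =
      if ∑ x ∈ S, f.eval x = b then (Fintype.card F : ℂ) else 0 := by
    intro S
    have h1 := AddChar.sum_apply_eq_ite (∑ x ∈ S, f.eval x - b)
    simp only [sub_eq_zero] at h1
    rw [← h1]
    refine sum_congr rfl fun ψ _ => ?_
    rw [sub_eq_neg_add, AddChar.map_add_eq_mul, addChar_map_sum]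
  simp only [mul_sum]
  rw [sum_comm]
  simp only [h]
  rw [polySubsetSumCount, ← sum_filter, sum_const, nsmul_eq_mul, mul_comm]

theorem abs_polySubsetSumCount_sub_le {F : Type*} [Field F] [Fintype F] [DecidableEq F]
    (f : Polynomial F) (D : Finset F) (k : ℕ) (b : F) {R : ℝ} (hR0 : 0 ≤ R)
    (hR : ∀ ψ : AddChar F ℂ, ψ ≠ 1 → ‖∑ S ∈ D.powersetCard k, ∏ x ∈ S, ψ (f.eval x)‖ ≤ R) :
    |(polySubsetSumCount D f k b : ℝ) - (1 / (Fintype.card F : ℝ)) * (D.card.choose k : ℝ)| ≤ R := by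
  classical
  have hq : (0 : ℝ) < Fintype.card F := by exact_mod_cast Fintype.card_pos
  have h := card_mul_polySubsetSumCount f D k b
  rw [← add_sum_erase _ _ (mem_univ (1 : AddChar F ℂ))] at h
  simp only [AddChar.one_apply, prod_const_one, sum_const, card_powersetCard, nsmul_eq_mul,
    mul_one, one_mul] at h
  have h2 : ‖(Fintype.card F : ℂ) * polySubsetSumCount D f k b - (D.card.choose k : ℂ)‖ ≤
      Fintype.card F * R := by
    rw [h, add_sub_cancel_left]
    refine (norm_sum_le _ _).trans ?_
    calc ∑ ψ ∈ univ.erase (1 : AddChar F ℂ),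
          ‖ψ (-b) * ∑ S ∈ D.powersetCard k, ∏ x ∈ S, ψ (f.eval x)‖
        ≤ ∑ ψ ∈ univ.erase (1 : AddChar F ℂ), R := by
          refine sum_le_sum fun ψ hψ => ?_
          rw [norm_mul, AddChar.norm_apply, one_mul]
          exact hR ψ (ne_of_mem_erase hψ)
      _ ≤ ∑ ψ : AddChar F ℂ, R := sum_le_sum_of_subset_of_nonneg (erase_subset _ _) fun _ _ _ => hR0
      _ = Fintype.card F * R := by simp [AddChar.card_eq]
  have h3 : (Fintype.card F : ℂ) * polySubsetSumCount D f k b - (D.card.choose k : ℂ) =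
      ((Fintype.card F * polySubsetSumCount D f k b - D.card.choose k : ℝ) : ℂ) := by push_cast; rfl
  rw [h3, Complex.norm_real, Real.norm_eq_abs] at h2
  have h4 : (polySubsetSumCount D f k b : ℝ) - (1 / (Fintype.card F : ℝ)) * (D.card.choose k : ℝ) =
      (Fintype.card F * polySubsetSumCount D f k b - D.card.choose k : ℝ) / Fintype.card F := by
    field_simp
  rw [h4, abs_div, abs_of_pos hq, div_le_iff₀ hq, mul_comm R]
  exact h2

theorem realChoose_natCast (n k : ℕ) : realChoose n k = n.choose k := by
  rw [realChoose, Nat.cast_choose_eq_descPochhammer_div, descPochhammer_eval_eq_prod_range]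

/-- **Theorem (polynomial subset sums over `𝔽_q`).**
Let `𝔽_q` have characteristic `p`, and let `f ∈ 𝔽_q[x]` have degree `d` with `p ∤ d`.
If `D ⊆ 𝔽_q` with `|D| = q - c ≥ (d-1)√q + c`, then for all `b` and `0 ≤ k ≤ |D|`,
`|N_f(D,k,b) - (1/q)·C(q-c,k)| ≤ C((q-c)/p + ((p-1)/p)((d-1)√q + c) + k - 1, k)`. -/
theorem polySubsetSum_asymptotic_finiteField
    (F : Type*) [Field F] [Fintype F] [DecidableEq F]
    (f : Polynomial F) (d : ℕ) (hdeg : f.natDegree = d) (hd : ¬ (ringChar F ∣ d))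
    (D : Finset F) (c : ℕ) (hD : (D.card : ℝ) = (Fintype.card F : ℝ) - c)
    (hbig : (Fintype.card F : ℝ) - c ≥
      ((d : ℝ) - 1) * Real.sqrt (Fintype.card F) + c)
    (b : F) (k : ℕ) (hk : k ≤ D.card) :
    |(polySubsetSumCount D f k b : ℝ)
        - (1 / (Fintype.card F : ℝ)) * realChoose ((Fintype.card F : ℝ) - c) k|
      ≤ realChoose
          (((Fintype.card F : ℝ) - c) / (ringChar F)
            + (((ringChar F : ℝ) - 1) / (ringChar F)) *
                (((d : ℝ) - 1) * Real.sqrt (Fintype.card F) + c)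
            + k - 1) k := by
  have hprime : (ringChar F).Prime := CharP.char_is_prime F (ringChar F)
  have : Fact (ringChar F).Prime := ⟨hprime⟩
  have hp0 : (0 : ℝ) < ringChar F := by exact_mod_cast hprime.pos
  have hp1 : (1 : ℝ) ≤ ringChar F := by exact_mod_cast hprime.one_le
  have hd1 : 1 ≤ d := Nat.one_le_iff_ne_zero.2 fun h => hd (h ▸ dvd_zero _)
  have hd1' : (0 : ℝ) ≤ (d : ℝ) - 1 := sub_nonneg.2 (by exact_mod_cast hd1)
  have hq1 : (1 : ℝ) ≤ Real.sqrt (Fintype.card F) :=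
    Real.one_le_sqrt.2 (by exact_mod_cast Fintype.card_pos)
  have hpq : (ringChar F : ℝ) ≤ Fintype.card F := by
    obtain ⟨n, -, hn⟩ := FiniteField.card F (ringChar F)
    rw [hn]
    exact_mod_cast Nat.le_self_pow n.pos.ne' _
  have hX : (1 : ℝ) ≤ (D.card : ℝ) / ringChar F + ((ringChar F - 1 : ℝ) / ringChar F) *
      (((d : ℝ) - 1) * Real.sqrt (Fintype.card F) + c) := by
    rw [div_mul_eq_mul_div, ← add_div, one_le_div hp0]
    by_cases h : d = 1 ∧ c = 0
    · obtain ⟨rfl, rfl⟩ := h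
      simpa [hD] using hpq
    · have hB : (1 : ℝ) ≤ ((d : ℝ) - 1) * Real.sqrt (Fintype.card F) + c := by
        by_cases hc : c = 0
        · have : 2 ≤ d := by omega
          have : (2 : ℝ) ≤ d := by exact_mod_cast this
          nlinarith [(Nat.cast_nonneg c : (0 : ℝ) ≤ c)]
        · have : (1 : ℝ) ≤ c := by exact_mod_cast Nat.one_le_iff_ne_zero.2 hc
          nlinarith
      nlinarith
  rw [← hD] at hbig ⊢
  rw [realChoose_natCast]
  subst hdeg
  refine abs_polySubsetSumCount_sub_le f D k b (realChoose_nonneg (zero_le_one.trans hX) k)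
    fun ψ hψ => ?_
  exact norm_sum_powersetCard_addChar_le
    (fun χ hχ => norm_sum_addChar_eval_le (p := ringChar F) f hd hχ) hD hbig hX hψ k
end

section
/- Let G be a finite abelian group of order n, let b ∈ G, and let 0 ≤ k ≤ n. Then N(G,k,b) = (1/n)·C(n,k) + (1/n)·∑_{d | gcd(n,k), d ≠ 1} (-1)^{k + k/d} · C(n/d, k/d) · ∑_{ψ : order(ψ) = d} ψ(b), where the inner sum is over all additive characters ψ of G of exact order d, and the identity holds as an equality of complex numbers. -/
open Finset

/-- `N(D, k, b)`: the number of `k`-element subsets `S ⊆ D` with `∑_{x ∈ S} x = b`. -/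
def subsetSumCount {G : Type*} [AddCommGroup G] [DecidableEq G]
    (D : Finset G) (k : ℕ) (b : G) : ℕ :=
  ((D.powersetCard k).filter (fun S => ∑ x ∈ S, x = b)).card

theorem orderOf_addChar_dvd_card {G : Type*} [AddCommGroup G] [Fintype G] (ψ : AddChar G ℂ) :
    orderOf ψ ∣ Fintype.card G := by
  refine orderOf_dvd_of_pow_eq_one ?_
  ext x
  rw [AddChar.pow_apply, ← AddChar.map_nsmul_eq_pow, card_nsmul_eq_zero, AddChar.map_zero_eq_one,
    AddChar.one_apply]

/-- A character of a finite group attains a primitive root of unity of its own order. -/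
theorem exists_isPrimitiveRoot_addChar_apply {G : Type*} [AddCommGroup G] [Finite G]
    (ψ : AddChar G ℂ) : ∃ x, IsPrimitiveRoot (ψ x) (orderOf ψ) := by
  let φ : Multiplicative G →* ℂˣ := ψ.toMonoidHom.toHomUnits
  have hφ (x : G) : (φ (Multiplicative.ofAdd x) : ℂ) = ψ x := rfl
  have hfin : Finite φ.range := Finite.of_surjective _ φ.rangeRestrict_surjective
  have hcyc : IsCyclic φ.range :=
    isCyclic_of_injective_ringHom ((Units.coeHom ℂ).comp φ.range.subtype)
      (Units.val_injective.comp Subtype.val_injective)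
  obtain ⟨⟨-, x, rfl⟩, hg⟩ := IsCyclic.exists_generator (α := φ.range)
  refine ⟨x.toAdd, ?_⟩
  suffices h : orderOf ψ = orderOf (ψ x.toAdd) from h ▸ IsPrimitiveRoot.orderOf _
  refine orderOf_eq_orderOf_iff.2 fun m => ⟨fun h => ?_, fun h => ?_⟩
  · rw [← AddChar.pow_apply, h, AddChar.one_apply]
  · ext y
    obtain ⟨i, hi⟩ := Subgroup.mem_zpowers_iff.1 (hg ⟨φ (Multiplicative.ofAdd y), _, rfl⟩)
    have hi' : φ x ^ i = φ (Multiplicative.ofAdd y) := congrArg Subtype.val hi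
    have hx : φ x ^ m = 1 := Units.ext (by simpa [← hφ] using h)
    have hy : φ (Multiplicative.ofAdd y) ^ m = 1 := by
      rw [← hi', ← zpow_natCast, ← zpow_mul, mul_comm, zpow_mul, zpow_natCast, hx, one_zpow]
    simpa [← hφ] using congrArg Units.val hy

open Polynomial in
/-- A character of order `d` takes each `d`-th root of unity as a value exactly `|G| / d` times. -/
theorem prod_X_sub_C_addChar {G : Type*} [AddCommGroup G] [Fintype G] (ψ : AddChar G ℂ) :
    ∏ x, (X - C (ψ x)) = (X ^ orderOf ψ - 1 : ℂ[X]) ^ (Fintype.card G / orderOf ψ) := by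
  classical
  obtain ⟨x₀, hx₀⟩ := exists_isPrimitiveRoot_addChar_apply ψ
  have hd : 0 < orderOf ψ := orderOf_pos ψ
  have : NeZero (orderOf ψ) := ⟨hd.ne'⟩
  have hmaps (x : G) (_ : x ∈ univ) : ψ x ∈ nthRootsFinset (orderOf ψ) (1 : ℂ) := by
    rw [mem_nthRootsFinset hd, ← AddChar.pow_apply, pow_orderOf_eq_one, AddChar.one_apply]
  have hfib (ζ : ℂ) (hζ : ζ ∈ nthRootsFinset (orderOf ψ) (1 : ℂ)) :
      #{x | ψ x = ζ} = #{x | ψ x = 1} := by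
    obtain ⟨i, -, rfl⟩ := hx₀.eq_pow_of_pow_eq_one ((mem_nthRootsFinset hd _).1 hζ)
    refine (card_equiv (Equiv.addLeft (i • x₀)) fun x => ?_).symm
    have h0 : ψ x₀ ^ i ≠ 0 := pow_ne_zero _ (hx₀.ne_zero hd.ne')
    simp [AddChar.map_add_eq_mul, AddChar.map_nsmul_eq_pow, h0]
  have hcard : Fintype.card G = orderOf ψ * #{x | ψ x = 1} := by
    rw [← card_univ, card_eq_sum_card_fiberwise hmaps, sum_congr rfl hfib, sum_const,
      hx₀.card_nthRootsFinset, smul_eq_mul]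
  rw [hcard, Nat.mul_div_cancel_left _ hd, X_pow_sub_one_eq_prod hd hx₀, ← prod_pow,
    ← prod_fiberwise_of_maps_to hmaps]
  refine prod_congr rfl fun ζ hζ => ?_
  rw [← hfib ζ hζ, ← prod_const]
  exact prod_congr rfl fun x hx => by rw [(mem_filter.1 hx).2]

open Polynomial in
/-- The elementary symmetric functions of the values of a character. -/
theorem sum_powersetCard_addChar {G : Type*} [AddCommGroup G] [Fintype G] (ψ : AddChar G ℂ)
    {k : ℕ} (hk : k ≤ Fintype.card G) :
    ∑ S ∈ powersetCard k (univ : Finset G), ψ (∑ x ∈ S, x) =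
      if orderOf ψ ∣ k then
        (-1) ^ (k + k / orderOf ψ) *
          ((Fintype.card G / orderOf ψ).choose (k / orderOf ψ) : ℂ)
      else 0 := by
  have hd : 0 < orderOf ψ := orderOf_pos ψ
  have hdvd := orderOf_addChar_dvd_card ψ
  have hesymm : ∑ S ∈ powersetCard k (univ : Finset G), ψ (∑ x ∈ S, x) =
      ((univ : Finset G).val.map ψ).esymm k := by
    rw [esymm_map_val]
    exact sum_congr rfl fun S _ => map_prod ψ.toMonoidHom (fun x => Multiplicative.ofAdd x) S
  have hcoeff := congrArg (fun p => coeff p (Fintype.card G - k)) (prod_X_sub_C_addChar ψ)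
  have hexpand : (X ^ orderOf ψ - 1 : ℂ[X]) ^ (Fintype.card G / orderOf ψ) =
      expand ℂ (orderOf ψ) ((X + C (-1)) ^ (Fintype.card G / orderOf ψ)) := by
    simp [sub_eq_add_neg]
  have hprod : ∏ x, (X - C (ψ x)) =
      (((univ : Finset G).val.map ψ).map fun t => X - C t).prod := by
    rw [Multiset.map_map]; rfl
  have hc : Multiset.card ((univ : Finset G).val.map ψ) = Fintype.card G := by simp
  simp only [hexpand, hprod] at hcoeff
  rw [Multiset.prod_X_sub_C_coeff _ (by rw [hc]; exact Nat.sub_le _ _), hc, Nat.sub_sub_self hk,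
    ← hesymm, coeff_expand hd, coeff_X_add_C_pow] at hcoeff
  simp only [Nat.dvd_sub_iff_right hk hdvd] at hcoeff
  have hsign : (-1 : ℂ) ^ k * (-1) ^ k = 1 := by rw [← mul_pow]; simp
  replace hcoeff := congrArg ((-1) ^ k * ·) hcoeff
  simp only [← mul_assoc, hsign, one_mul] at hcoeff
  rw [hcoeff]
  split_ifs with h
  · obtain ⟨m, hm⟩ := hdvd
    obtain ⟨j, rfl⟩ := h
    rw [hm] at hk ⊢
    have hj : j ≤ m := Nat.le_of_mul_le_mul_left hk hd
    rw [← Nat.mul_sub, Nat.mul_div_cancel_left _ hd, Nat.mul_div_cancel_left _ hd,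
      Nat.mul_div_cancel_left _ hd, Nat.sub_sub_self hj, Nat.choose_symm hj, pow_add, mul_assoc]
  · exact mul_zero _

open scoped Classical in
/-- **Theorem (explicit formula for the number of `k`-subsets of `G` summing to `b`).**
For a finite abelian group `G` of order `n` and `0 ≤ k ≤ n`,
`N(G,k,b) = (1/n)·C(n,k) + (1/n)·∑_{1 ≠ d ∣ (n,k)} (-1)^{k+k/d}·C(n/d, k/d)·∑_{ord(ψ)=d} ψ(b)`,
the inner sum being over all additive characters `ψ` of `G` of exact order `d`. -/
theorem subsetSum_explicit_formula
    (G : Type*) [AddCommGroup G] [Fintype G] [DecidableEq G]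
    (n : ℕ) (hn : Fintype.card G = n) (b : G) (k : ℕ) (hk : k ≤ n) :
    (subsetSumCount (Finset.univ : Finset G) k b : ℂ)
      = (1 / (n : ℂ)) * (n.choose k : ℂ)
        + (1 / (n : ℂ)) *
            ∑ d ∈ (Nat.gcd n k).divisors.filter (fun d => d ≠ 1),
              (-1 : ℂ) ^ (k + k / d) * ((n / d).choose (k / d) : ℂ) *
                ∑ ψ ∈ Finset.univ.filter (fun ψ : AddChar G ℂ => orderOf ψ = d),
                  ψ b := by
  subst hn
  set n := Fintype.card G
  have hn0 : (n : ℂ) ≠ 0 := Nat.cast_ne_zero.2 Fintype.card_ne_zero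
  set c : ℕ → ℂ := fun d => (-1) ^ (k + k / d) * ((n / d).choose (k / d) : ℂ) with hc
  have hcount : (n : ℂ) * subsetSumCount (univ : Finset G) k b =
      ∑ ψ : AddChar G ℂ, ψ b * if orderOf ψ ∣ k then c (orderOf ψ) else 0 := by
    calc (n : ℂ) * subsetSumCount (univ : Finset G) k b
        = ∑ S ∈ powersetCard k (univ : Finset G), ∑ ψ : AddChar G ℂ, ψ (∑ x ∈ S, x - b) := by
          simp_rw [AddChar.sum_apply_eq_ite, sub_eq_zero]
          rw [← sum_filter, sum_const, nsmul_eq_mul, mul_comm]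
          rfl
      _ = ∑ ψ : AddChar G ℂ, ψ (-b) * ∑ S ∈ powersetCard k (univ : Finset G), ψ (∑ x ∈ S, x) := by
          rw [sum_comm]
          simp_rw [mul_sum, ← AddChar.map_add_eq_mul, sub_eq_neg_add]
      _ = ∑ ψ : AddChar G ℂ, ψ b * ∑ S ∈ powersetCard k (univ : Finset G), ψ⁻¹ (∑ x ∈ S, x) := by
          refine Fintype.sum_equiv (Equiv.inv _) _ _ fun ψ => ?_
          simp [AddChar.inv_apply]
      _ = _ := by
          refine sum_congr rfl fun ψ _ => ?_
          rw [sum_powersetCard_addChar ψ⁻¹ hk, orderOf_inv]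
  have hgroup : ∑ ψ : AddChar G ℂ, ψ b * (if orderOf ψ ∣ k then c (orderOf ψ) else 0) =
      ∑ d ∈ (n.gcd k).divisors, c d * ∑ ψ : AddChar G ℂ with orderOf ψ = d, ψ b := by
    simp_rw [mul_ite, mul_zero]
    rw [← sum_filter, ← sum_fiberwise_of_maps_to (g := fun ψ : AddChar G ℂ => orderOf ψ)
      (t := (n.gcd k).divisors)]
    · refine sum_congr rfl fun d hd => ?_
      have hdk : d ∣ k := (Nat.dvd_of_mem_divisors hd).trans (Nat.gcd_dvd_right _ _)
      rw [mul_sum, filter_filter]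
      refine sum_congr (filter_congr fun ψ _ => ⟨And.right, fun h => ⟨h ▸ hdk, h⟩⟩) fun ψ hψ => ?_
      rw [(mem_filter.1 hψ).2, mul_comm]
    · intro ψ hψ
      exact Nat.mem_divisors.2 ⟨Nat.dvd_gcd (orderOf_addChar_dvd_card ψ) (mem_filter.1 hψ).2,
        (Nat.gcd_pos_of_pos_left _ Fintype.card_pos).ne'⟩
  have hone : c 1 * ∑ ψ : AddChar G ℂ with orderOf ψ = 1, ψ b = n.choose k := by
    simp [hc, orderOf_eq_one_iff, filter_eq', ← two_mul]
  have hmem : 1 ∈ (n.gcd k).divisors :=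
    Nat.one_mem_divisors.2 (Nat.gcd_pos_of_pos_left _ Fintype.card_pos).ne'
  rw [← mul_add, one_div, eq_inv_mul_iff_mul_eq₀ hn0, hcount, hgroup, filter_ne',
    ← add_sum_erase _ _ hmem, hone]
end

section
/- Let n ≥ 1, d ≥ 2 and k ≥ 1 be integers. Then ∑_{τ} (-n)^{l(τ)} = (-1)^{k/d} · k! · C(n/d, k/d) if d | k, and this sum equals 0 if d ∤ k, where the sum ranges over all permutations τ ∈ S_k all of whose cycle lengths (including fixed points counted as 1-cycles) are divisible by d, l(τ) denotes the total number of cycles of τ, and C(n/d, k/d) = (n/d)(n/d - 1)⋯(n/d - k/d + 1)/(k/d)! is the binomial coefficient with rational upper argument n/d. The identity holds in ℚ. -/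
open Finset

/-- The number of cycles of length `i` of a permutation `τ ∈ S_k`
(fixed points counted as `1`-cycles). -/
def cycleCount {k : ℕ} (τ : Equiv.Perm (Fin k)) (i : ℕ) : ℕ :=
  if i = 1 then (Finset.univ.filter fun x => τ x = x).card
  else Multiset.count i τ.cycleType

/-- The multisets of parts of the partitions of `k` into multiples of `d`. -/
def multiplePartitions (d k : ℕ) : Finset (Multiset ℕ) :=
  ((univ : Finset k.Partition).image Nat.Partition.parts).filter fun s => ∀ i ∈ s, d ∣ i

theorem mem_multiplePartitions {d k : ℕ} {s : Multiset ℕ} :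
    s ∈ multiplePartitions d k ↔ s.sum = k ∧ (∀ i ∈ s, 0 < i) ∧ ∀ i ∈ s, d ∣ i := by
  simp only [multiplePartitions, mem_filter, mem_image, mem_univ, true_and]
  constructor
  · rintro ⟨⟨p, rfl⟩, h⟩
    exact ⟨p.parts_sum, fun i hi => p.parts_pos hi, h⟩
  · rintro ⟨hs, hpos, h⟩
    exact ⟨⟨⟨s, fun {i} hi => hpos i hi, hs⟩, rfl⟩, h⟩

/-- The proportion of permutations of cycle type `s` among all permutations of `s.sum` points,
weighted by `x` to the number of cycles. -/
def cycleTypeWeight (x : ℚ) (s : Multiset ℕ) : ℚ :=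
  x ^ s.card / ((s.prod : ℚ) * ∏ i ∈ s.toFinset, ((s.count i).factorial : ℚ))

theorem prod_count_factorial_cons (i : ℕ) (s : Multiset ℕ) :
    ∏ j ∈ (i ::ₘ s).toFinset, (((i ::ₘ s).count j).factorial : ℚ)
      = (s.count i + 1) * ∏ j ∈ s.toFinset, ((s.count j).factorial : ℚ) := by
  have h : ∏ j ∈ s.toFinset, ((s.count j).factorial : ℚ)
      = ∏ j ∈ insert i s.toFinset, ((s.count j).factorial : ℚ) := by
    refine prod_subset (subset_insert _ _) fun j _ hj => ?_
    rw [Multiset.mem_toFinset] at hj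
    simp [Multiset.count_eq_zero_of_notMem hj]
  rw [h, Multiset.toFinset_cons, ← mul_prod_erase _ _ (mem_insert_self i s.toFinset),
    ← mul_prod_erase _ (fun j => ((s.count j).factorial : ℚ)) (mem_insert_self i s.toFinset),
    Multiset.count_cons_self, Nat.factorial_succ, Nat.cast_mul, Nat.cast_succ, mul_assoc]
  congr 2
  refine prod_congr rfl fun j hj => ?_
  rw [Multiset.count_cons_of_ne (ne_of_mem_erase hj)]

theorem count_mul_cycleTypeWeight (x : ℚ) {i : ℕ} {s : Multiset ℕ} (hi : i ∈ s) (hi0 : 0 < i) :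
    ((s.count i : ℚ) * i) * cycleTypeWeight x s = x * cycleTypeWeight x (s.erase i) := by
  obtain ⟨t, rfl⟩ := Multiset.exists_cons_of_mem hi
  have h1 : (i : ℚ) ≠ 0 := by positivity
  have h2 : (t.count i : ℚ) + 1 ≠ 0 := by positivity
  rw [Multiset.erase_cons_head, cycleTypeWeight, cycleTypeWeight, prod_count_factorial_cons,
    Multiset.count_cons_self, Multiset.prod_cons, Multiset.card_cons, pow_succ,
    Nat.cast_mul, Nat.cast_succ]
  rw [mul_div_assoc', mul_div_assoc',
    show (i : ℚ) * t.prod * ((t.count i + 1) * ∏ j ∈ t.toFinset, ((t.count j).factorial : ℚ))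
      = ((t.count i + 1) * i) * (t.prod * ∏ j ∈ t.toFinset, ((t.count j).factorial : ℚ)) by ring,
    mul_div_mul_left _ _ (mul_ne_zero h2 h1), mul_comm x]

theorem mul_sum_cycleTypeWeight (x : ℚ) (d k : ℕ) :
    (k : ℚ) * ∑ s ∈ multiplePartitions d k, cycleTypeWeight x s
      = x * ∑ i ∈ (Icc 1 k).filter (d ∣ ·),
          ∑ s ∈ multiplePartitions d (k - i), cycleTypeWeight x s := by
  have h : ∀ s ∈ multiplePartitions d k, (k : ℚ) * cycleTypeWeight x s
      = ∑ i ∈ s.toFinset, x * cycleTypeWeight x (s.erase i) := by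
    intro s hs
    obtain ⟨hsum, hpos, -⟩ := mem_multiplePartitions.1 hs
    rw [← hsum, Finset.sum_multiset_count s, Nat.cast_sum, sum_mul]
    refine sum_congr rfl fun i hi => ?_
    rw [Multiset.mem_toFinset] at hi
    rw [← count_mul_cycleTypeWeight x hi (hpos i hi), smul_eq_mul, Nat.cast_mul]
  rw [mul_sum, sum_congr rfl h, mul_sum]
  simp only [mul_sum]
  rw [sum_sigma', sum_sigma']
  refine sum_bij' (fun a _ => ⟨a.2, a.1.erase a.2⟩) (fun a _ => ⟨a.1 ::ₘ a.2, a.1⟩) ?_ ?_ ?_ ?_ ?_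
  · rintro ⟨s, i⟩ ha
    simp only [mem_sigma, mem_multiplePartitions, Multiset.mem_toFinset, mem_filter, mem_Icc]
      at ha ⊢
    obtain ⟨⟨hsum, hpos, hdvd⟩, hi⟩ := ha
    have := Multiset.sum_erase hi
    have := hpos i hi
    exact ⟨⟨⟨this, by omega⟩, hdvd i hi⟩, by omega,
      fun j hj => hpos j (Multiset.mem_of_mem_erase hj),
      fun j hj => hdvd j (Multiset.mem_of_mem_erase hj)⟩
  · rintro ⟨i, s⟩ ha
    simp only [mem_sigma, mem_multiplePartitions, Multiset.mem_toFinset, mem_filter, mem_Icc,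
      Multiset.sum_cons, Multiset.mem_cons, forall_eq_or_imp, true_or, and_true] at ha ⊢
    obtain ⟨⟨⟨h1, h2⟩, h3⟩, h4, h5, h6⟩ := ha
    exact ⟨by omega, ⟨h1, h5⟩, h3, h6⟩
  · rintro ⟨s, i⟩ ha
    simp only [mem_sigma, Multiset.mem_toFinset] at ha
    simp [Multiset.cons_erase ha.2]
  · rintro ⟨i, s⟩ ha
    simp
  · rintro ⟨s, i⟩ ha
    rfl

theorem sum_cycleTypeWeight_step (x : ℚ) {d k : ℕ} (hd : 0 < d) :
    ((k + d : ℕ) : ℚ) * ∑ s ∈ multiplePartitions d (k + d), cycleTypeWeight x s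
      = (x + k) * ∑ s ∈ multiplePartitions d k, cycleTypeWeight x s := by
  have h : (Icc 1 (k + d)).filter (d ∣ ·)
      = insert d (((Icc 1 k).filter (d ∣ ·)).image (· + d)) := by
    ext i
    simp only [mem_filter, mem_Icc, mem_insert, mem_image]
    constructor
    · rintro ⟨⟨h1, h2⟩, h3⟩
      have := Nat.le_of_dvd h1 h3
      rcases this.eq_or_lt with h | h
      · exact Or.inl h.symm
      · exact Or.inr ⟨i - d, ⟨⟨by omega, by omega⟩, Nat.dvd_sub h3 dvd_rfl⟩, by omega⟩
    · rintro (rfl | ⟨j, ⟨⟨h1, h2⟩, h3⟩, rfl⟩)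
      · exact ⟨⟨hd, by omega⟩, dvd_rfl⟩
      · exact ⟨⟨by omega, by omega⟩, Nat.dvd_add_self_right.2 h3⟩
  rw [mul_sum_cycleTypeWeight, h, sum_insert, sum_image (by intro a _ b _; simp), mul_add,
    Nat.add_sub_cancel, add_mul, mul_sum_cycleTypeWeight]
  · simp only [Nat.add_sub_add_right]
  · simp

theorem sum_cycleTypeWeight_mul (x : ℚ) {d : ℕ} (hd : 0 < d) (m : ℕ) :
    ∑ s ∈ multiplePartitions d (d * m), cycleTypeWeight x s
      = (∏ j ∈ range m, (x / d + j)) / m.factorial := by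
  induction m with
  | zero =>
    have h : multiplePartitions d (d * 0) = {0} := by
      ext s
      rw [mem_multiplePartitions, mem_singleton]
      constructor
      · rintro ⟨h1, h2, -⟩
        refine Multiset.eq_zero_of_forall_notMem fun i hi => ?_
        have := Multiset.le_sum_of_mem hi
        have := h2 i hi
        omega
      · rintro rfl
        simp
    rw [h]
    simp [cycleTypeWeight]
  | succ m ih =>
    have h := sum_cycleTypeWeight_step x (k := d * m) hd
    rw [ih, ← Nat.mul_succ] at h
    have hd' : (d : ℚ) ≠ 0 := by positivity
    have hm : (m.factorial : ℚ) ≠ 0 := by positivity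
    have hm' : (m : ℚ) + 1 ≠ 0 := by positivity
    rw [prod_range_succ, Nat.factorial_succ]
    push_cast at h ⊢
    rw [← mul_right_inj' (mul_ne_zero hd' hm'), h]
    field_simp

theorem multiplePartitions_eq_empty {d k : ℕ} (h : ¬ d ∣ k) : multiplePartitions d k = ∅ := by
  refine eq_empty_of_forall_notMem fun s hs => h ?_
  obtain ⟨hsum, -, hdvd⟩ := mem_multiplePartitions.1 hs
  exact hsum ▸ Multiset.dvd_sum hdvd

theorem cycleCount_eq_count {k : ℕ} (τ : Equiv.Perm (Fin k)) (i : ℕ) :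
    cycleCount τ i = τ.partition.parts.count i := by
  have hfix : (univ.filter fun x => τ x = x).card = k - τ.support.card := by
    have h := card_compl τ.support
    rw [Fintype.card_fin] at h
    rw [← h]
    congr 1
    ext x
    simp
  rw [cycleCount, Equiv.Perm.parts_partition, Multiset.count_add, Multiset.count_replicate,
    Fintype.card_fin]
  split_ifs with h1 h2 h2
  · subst h1
    rw [hfix, Multiset.count_eq_zero_of_notMem, zero_add]
    exact fun h => absurd (Equiv.Perm.two_le_of_mem_cycleType h) (by norm_num)
  · exact absurd h1.symm h2
  · exact absurd h2.symm h1
  · rfl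

theorem mem_Icc_of_mem_partition {k : ℕ} (τ : Equiv.Perm (Fin k)) {i : ℕ}
    (hi : i ∈ τ.partition.parts) : i ∈ Icc 1 k := by
  have h := τ.partition.parts_sum.trans (Fintype.card_fin k)
  exact mem_Icc.2 ⟨τ.partition.parts_pos hi, h ▸ Multiset.le_sum_of_mem hi⟩

theorem sum_cycleCount {k : ℕ} (τ : Equiv.Perm (Fin k)) :
    ∑ i ∈ Icc 1 k, cycleCount τ i = τ.partition.parts.card := by
  simp only [cycleCount_eq_count]
  exact Multiset.sum_count_eq_card fun i hi => mem_Icc_of_mem_partition τ hi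

theorem forall_dvd_cycleCount_iff {d k : ℕ} (τ : Equiv.Perm (Fin k)) :
    (∀ i ∈ Icc 1 k, cycleCount τ i ≠ 0 → d ∣ i) ↔
      τ.partition.parts ∈ multiplePartitions d k := by
  have h := τ.partition.parts_sum.trans (Fintype.card_fin k)
  simp only [mem_multiplePartitions, h, true_and, cycleCount_eq_count, Multiset.count_ne_zero]
  exact ⟨fun H => ⟨fun i hi => τ.partition.parts_pos hi,
    fun i hi => H i (mem_Icc_of_mem_partition τ hi) hi⟩, fun H i _ hi => H.2 i hi⟩

theorem card_partition_eq {d k : ℕ} (hd : 2 ≤ d) {s : Multiset ℕ}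
    (hs : s ∈ multiplePartitions d k) :
    ((univ.filter fun τ : Equiv.Perm (Fin k) => τ.partition.parts = s).card : ℚ)
      = k.factorial / ((s.prod : ℚ) * ∏ i ∈ s.toFinset, ((s.count i).factorial : ℚ)) := by
  obtain ⟨hsum, hpos, hdvd⟩ := mem_multiplePartitions.1 hs
  have htwo : ∀ i ∈ s, 2 ≤ i := fun i hi => hd.trans (Nat.le_of_dvd (hpos i hi) (hdvd i hi))
  have heq : (univ.filter fun τ : Equiv.Perm (Fin k) => τ.partition.parts = s)
      = univ.filter fun τ : Equiv.Perm (Fin k) => τ.cycleType = s := by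
    ext τ
    simp only [mem_filter, mem_univ, true_and]
    rw [Equiv.Perm.parts_partition, Fintype.card_fin]
    constructor
    · intro h
      have h0 : k - τ.support.card = 0 := by
        by_contra hne
        have : 1 ∈ s := by
          rw [← h]
          exact Multiset.mem_add.2 (Or.inr (Multiset.mem_replicate.2 ⟨hne, rfl⟩))
        exact absurd (htwo 1 this) (by norm_num)
      simpa [h0] using h
    · intro h
      rw [← Equiv.Perm.sum_cycleType, h, hsum]
      simp
  have hcard := Equiv.Perm.card_of_cycleType_mul_eq (Fin k) s
  rw [Fintype.card_fin, if_pos ⟨hsum.le, htwo⟩, hsum, Nat.sub_self, Nat.factorial_zero,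
    one_mul] at hcard
  have hprod : (s.prod : ℚ) ≠ 0 := by
    exact_mod_cast Multiset.prod_ne_zero fun h => (hpos 0 h).ne' rfl
  have hfac : ∏ i ∈ s.toFinset, ((s.count i).factorial : ℚ) ≠ 0 :=
    prod_ne_zero_iff.2 fun i _ => by positivity
  rw [heq, eq_div_iff (mul_ne_zero hprod hfac)]
  exact_mod_cast hcard

theorem sum_pow_card_parts (x : ℚ) {d : ℕ} (hd : 2 ≤ d) (k : ℕ) :
    ∑ τ : Equiv.Perm (Fin k) with τ.partition.parts ∈ multiplePartitions d k,
        x ^ τ.partition.parts.card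
      = k.factorial * ∑ s ∈ multiplePartitions d k, cycleTypeWeight x s := by
  rw [← sum_fiberwise_of_maps_to (t := multiplePartitions d k)
    (g := fun τ : Equiv.Perm (Fin k) => τ.partition.parts) fun τ hτ => (mem_filter.1 hτ).2, mul_sum]
  refine sum_congr rfl fun s hs => ?_
  have hfilter : ((univ.filter fun τ : Equiv.Perm (Fin k) =>
      τ.partition.parts ∈ multiplePartitions d k).filter fun τ => τ.partition.parts = s)
      = univ.filter fun τ : Equiv.Perm (Fin k) => τ.partition.parts = s := by
    ext τ
    simp only [mem_filter, mem_univ, true_and, and_iff_right_iff_imp]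
    rintro rfl
    exact hs
  rw [hfilter, sum_congr rfl fun τ hτ => by rw [(mem_filter.1 hτ).2], sum_const, nsmul_eq_mul,
    card_partition_eq hd hs, cycleTypeWeight]
  ring


open scoped Classical in
/-- **Lemma (signed cycle count sum).** For integers `n ≥ 1`, `d ≥ 2`, `k ≥ 1`, the sum of
`(-n)^{l(τ)}` over all permutations `τ ∈ S_k` all of whose cycle lengths (fixed points
counted as `1`-cycles) are divisible by `d` equals `(-1)^{k/d}·k!·C(n/d, k/d)` if `d ∣ k`,
and `0` otherwise, where `l(τ)` is the total number of cycles of `τ` and `C(n/d, k/d)` is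
the binomial coefficient with rational upper argument `n/d`. -/
theorem signed_cycle_count_sum
    (n d k : ℕ) (hn : 1 ≤ n) (hd : 2 ≤ d) (hk : 1 ≤ k) :
    ∑ τ ∈ (Finset.univ : Finset (Equiv.Perm (Fin k))).filter
        (fun τ => ∀ i ∈ Finset.Icc 1 k, cycleCount τ i ≠ 0 → d ∣ i),
        (-(n : ℚ)) ^ (∑ i ∈ Finset.Icc 1 k, cycleCount τ i)
      = if d ∣ k then
          (-1 : ℚ) ^ (k / d) * (Nat.factorial k : ℚ) *
            ((∏ j ∈ Finset.range (k / d), ((n : ℚ) / d - j)) /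
              (Nat.factorial (k / d) : ℚ))
        else 0 := by
  simp only [forall_dvd_cycleCount_iff, sum_cycleCount]
  have h := sum_pow_card_parts (-(n : ℚ)) hd k
  have hd0 : 0 < d := by omega
  split_ifs with hdvd
  · obtain ⟨m, rfl⟩ := hdvd
    rw [sum_cycleTypeWeight_mul _ hd0] at h
    rw [Nat.mul_div_cancel_left m hd0]
    have hneg : ∏ j ∈ range m, (-(n : ℚ) / d + j)
        = (-1) ^ m * ∏ j ∈ range m, ((n : ℚ) / d - j) := by
      rw [← card_range m, ← prod_const, card_range, ← prod_mul_distrib]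
      exact prod_congr rfl fun j _ => by ring
    rw [hneg] at h
    convert h using 1
    ring
  · rw [sum_congr (multiplePartitions_eq_empty hdvd) fun _ _ => rfl, sum_empty, mul_zero] at h
    convert h
end
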